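/- arXiv:0901.1560 — 3 statements merged into one kernel-verified Lean document; each statement's English description precedes it below -/
import Mathlib

section
/- Let R be an arithmetical ring. Then the following conditions are equivalent: (1) for each maximal ideal P, the localization R_P is either coherent or not semicoherent; (2) for each multiplicative subset S of R and each injective R-module G of finite Goldie dimension, S^{-1}G is an injective R-module; (3) for each multiplicative subset S of R and each FP-injective R-module G of finite Goldie dimension, S^{-1}G is FP-injective; (4) for each maximal ideal P, the module Q(R_P) ⊗_R E_R(R/P) is FP-injective, where Q(R_P) denotes the total ring of quotients of R_P. -/
universe u

/-- A ring is *coherent* if every finitely generated ideal is finitely presented. -/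
def IsCoherentRing (R : Type u) [CommRing R] : Prop :=
  ∀ I : Ideal R, I.FG → Module.FinitePresentation R I

/-- A ring is *semicoherent* if `Hom_R(E, F)` is (isomorphic to) a submodule of a flat module
for every pair of injective modules `E`, `F`. -/
def IsSemicoherentRing (R : Type u) [CommRing R] : Prop :=
  ∀ (E F : Type u) [AddCommGroup E] [Module R E] [AddCommGroup F] [Module R F],
    Module.Injective R E → Module.Injective R F →
      ∃ G : ModuleCat.{u} R, Module.Flat R G ∧
        ∃ i : (E →ₗ[R] F) →ₗ[R] G, Function.Injective i

/-- An `R`-module `E` is *FP-injective* if `Ext¹_R(F, E) = 0` for every finitely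
presented `R`-module `F`. -/
def IsFPInjective (R : Type u) [CommRing R] (E : Type u) [AddCommGroup E] [Module R E] : Prop :=
  ∀ (F : Type u) [AddCommGroup F] [Module R F], Module.FinitePresentation R F →
    Subsingleton (((Ext R (ModuleCat.{u} R) 1).obj
      (Opposite.op (ModuleCat.of R F))).obj (ModuleCat.of R E))

/-- A ring is an *IF-ring* if every injective module over it is flat. -/
def IsIFRing (R : Type u) [CommRing R] : Prop :=
  ∀ (M : Type u) [AddCommGroup M] [Module R M], Module.Injective R M → Module.Flat R M

/-- `f : M →ₗ[R] E` exhibits `E` as an injective hull of `M`: `E` is injective and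
`f` embeds `M` as an essential submodule of `E`. -/
def IsInjectiveHull (R : Type u) [CommRing R] (M E : Type u) [AddCommGroup M] [Module R M]
    [AddCommGroup E] [Module R E] (f : M →ₗ[R] E) : Prop :=
  Module.Injective R E ∧ Function.Injective f ∧
    ∀ N : Submodule R E, N ≠ ⊥ → N ⊓ LinearMap.range f ≠ ⊥

/-- A module is indecomposable if it is nonzero and not the direct sum
of two nonzero submodules. -/
def IsIndecomposableModule (R : Type u) [CommRing R] (M : Type u) [AddCommGroup M]
    [Module R M] : Prop :=
  Nontrivial M ∧ ∀ A B : Submodule R M, IsCompl A B → A = ⊥ ∨ B = ⊥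

/-- A module has *finite Goldie dimension* if its injective hull is a finite direct
sum of indecomposable injective modules. -/
def HasFiniteGoldieDimension (R : Type u) [CommRing R] (M : Type u) [AddCommGroup M]
    [Module R M] : Prop :=
  ∃ (E : ModuleCat.{u} R) (f : M →ₗ[R] E), IsInjectiveHull R M E f ∧
    ∃ (n : ℕ) (D : Fin n → Submodule R E), DirectSum.IsInternal D ∧
      ∀ i, Module.Injective R (D i) ∧ IsIndecomposableModule R (D i)

/-- A commutative ring is a *valuation ring* (uniserial) if its ideals are totally
ordered by inclusion. -/
def IsChainRing (R : Type u) [CommRing R] : Prop :=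
  ∀ I J : Ideal R, I ≤ J ∨ J ≤ I

/-- A commutative ring is *arithmetical* if all its localizations at maximal ideals are
valuation rings. -/
def IsArithmetical (R : Type u) [CommRing R] : Prop :=
  ∀ (P : Ideal R) (hP : P.IsMaximal),
    haveI := hP.isPrime
    IsChainRing (Localization.AtPrime P)

/-- An `R`-module `M` is *finitely injective* if every homomorphism `A → M` from a finitely
generated submodule `A` of an arbitrary module `B` extends to `B`. -/
def IsFinitelyInjective (R : Type u) [CommRing R] (M : Type u) [AddCommGroup M]
    [Module R M] : Prop :=
  ∀ (B : Type u) [AddCommGroup B] [Module R B] (A : Submodule R B), A.FG →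
    ∀ f : A →ₗ[R] M, ∃ g : B →ₗ[R] M, ∀ a : A, g a = f a

/-- A domain has *finite character* if every nonzero element lies in only finitely many
maximal ideals. -/
def FiniteCharacter (R : Type u) [CommRing R] : Prop :=
  ∀ r : R, r ≠ 0 → {P : Ideal R | P.IsMaximal ∧ r ∈ P}.Finite

section PartA
open nonZeroDivisors

/-- `c` lies in the extension-contraction of `bV` to the total ring of quotients. -/
def InSat {V : Type u} [CommRing V] (b c : V) : Prop := ∃ s ∈ V⁰, b ∣ s * c

/-- Elementwise form of semicoherence for chain rings. -/
def SCProp (V : Type u) [CommRing V] : Prop :=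
  ∀ a : V, ∃ b : V, b * a = 0 ∧ ∀ c, c * b = 0 → InSat a c

section chain
variable {V : Type u} [CommRing V] 

lemma not_nzd {s : V} (hs : s ∉ V⁰) : ∃ z, z ≠ 0 ∧ s * z = 0 := by
  by_contra h
  push Not at h
  apply hs
  rw [mem_nonZeroDivisors_iff_right]
  intro x hx
  by_contra hx0
  exact h x hx0 (by rw [mul_comm]; exact hx)

lemma nzd_cancel {s x : V} (hs : s ∈ V⁰) (h : s * x = 0) : x = 0 :=
  (mem_nonZeroDivisors_iff_right.1 hs) x (by rw [mul_comm]; exact h)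

variable (hV : ∀ a b : V, a ∣ b ∨ b ∣ a)
include hV

lemma chain_unit (x : V) : IsUnit x ∨ IsUnit (1 - x) := by
  rcases hV x (1 - x) with h | h
  · left
    have : x ∣ x + (1 - x) := dvd_add dvd_rfl h
    rw [add_sub_cancel] at this
    exact isUnit_of_dvd_one this
  · right
    have : 1 - x ∣ x + (1 - x) := dvd_add h dvd_rfl
    rw [add_sub_cancel] at this
    exact isUnit_of_dvd_one this

lemma chain_L {s a : V} (hs : s ∉ V⁰) (ha : a ≠ 0) : ∃ y, y * (s * a) = 0 ∧ y * a ≠ 0 := by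
  obtain ⟨z, hz, hsz⟩ := not_nzd hs
  rcases hV a z with ⟨y, rfl⟩ | ⟨w, rfl⟩
  · exact ⟨y, by linear_combination hsz, by rwa [mul_comm]⟩
  · exact ⟨1, by linear_combination w * hsz, by simpa using ha⟩

lemma chain_notSat {a c : V} (h : ¬ InSat a c) : ∃ d, d ∉ V⁰ ∧ a = c * d := by
  rcases hV a c with h1 | ⟨d, hd⟩
  · exact absurd ⟨1, one_mem _, by simpa using h1⟩ h
  · refine ⟨d, fun hd' => h ⟨d, hd', ?_⟩, hd⟩
    rw [hd, mul_comm]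

lemma chain_DA {a b : V} (ha : a ≠ 0) (h : ∀ c, c * a = 0 → InSat b c) :
    ∀ c, c * b = 0 → InSat a c := by
  intro c hc
  by_contra hn
  obtain ⟨d, hd, rfl⟩ := chain_notSat hV hn
  have hc0 : c ≠ 0 := by rintro rfl; simp at ha
  obtain ⟨y, hy1, hy2⟩ := chain_L hV hd hc0
  obtain ⟨s, hs, k, hk⟩ := h y (by linear_combination hy1)
  exact hy2 (nzd_cancel hs (by linear_combination c * hk + k * hc))

lemma chain_nzd_sub {t w k : V} (ht : t ∈ V⁰) (hw : w ∉ V⁰) : t - w * k ∈ V⁰ := by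
  by_contra hn
  obtain ⟨z, hz, hz1⟩ := not_nzd hn
  obtain ⟨z', hz', hz1'⟩ := not_nzd hw
  rcases hV z z' with ⟨m, rfl⟩ | ⟨m, rfl⟩
  · exact hz' (nzd_cancel ht (by linear_combination m * hz1 + k * hz1'))
  · exact hz (nzd_cancel ht (by linear_combination hz1 + k * m * hz1'))

lemma chain_SC_of_pair {a0 b0 : V} (ha0 : a0 ≠ 0) (hb0 : b0 ≠ 0) (hab : a0 * b0 = 0)
    (h : ∀ c, c * a0 = 0 → InSat b0 c) : SCProp V := by
  have h' := chain_DA hV ha0 h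
  intro a
  rcases hV a a0 with ⟨d, hd⟩ | ⟨d, hd⟩
  · refine ⟨d * b0, by linear_combination hab - b0 * hd, ?_⟩
    intro y hy
    obtain ⟨s, hs, v, hv⟩ := h' (y * d) (by linear_combination hy)
    rcases hV a (s * y) with h1 | ⟨w, hw⟩
    · exact ⟨s, hs, h1⟩
    · rcases chain_unit hV (w * v) with h1 | h1
      · have hwu : IsUnit w := isUnit_of_mul_isUnit_left h1
        refine ⟨s, hs, ?_⟩
        obtain ⟨w', rfl⟩ := hwu
        exact ⟨↑w'⁻¹, by rw [hw, mul_assoc, Units.mul_inv, mul_one]⟩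
      · exfalso
        apply ha0
        have : d * (s * y) * (1 - w * v) = 0 := by
          subst hd
          linear_combination hv + d * v * hw 
        have h2 : d * (s * y) = 0 := by
          have := h1.mul_left_eq_zero.1 this
          exact this
        rw [hd, hw]; linear_combination w * h2
  · by_cases ha : a = 0
    · refine ⟨1, by simp [ha], ?_⟩
      intro c hc
      refine ⟨1, one_mem _, ?_⟩
      simp at hc; simp [hc]
    rcases hV b0 d with ⟨e, he⟩ | ⟨b', hb'⟩
    · exact absurd (by rw [hd, he]; linear_combination e * hab) ha
    refine ⟨b', by rw [hd]; linear_combination hab - a0 * hb', ?_⟩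
    intro y hy
    obtain ⟨s, hs, v, hv⟩ := h' y (by rw [hb']; linear_combination d * hy)
    rcases hV d v with ⟨v', rfl⟩ | ⟨w, hw⟩
    · exact ⟨s, hs, v', by rw [hv, hd]; ring⟩
    · obtain ⟨t, ht, k, hk⟩ := h (b' * v) (by linear_combination s * hy - b' * hv)
      have hvb : v * b' ≠ 0 := by
        intro h0; apply hb0; rw [hb', hw]; linear_combination w * h0
      have hwn : w ∈ V⁰ := by
        by_contra hwn
        apply hvb
        apply nzd_cancel (chain_nzd_sub hV ht hwn (k := k))
        rw [hb', hw] at hk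
        linear_combination hk
      refine ⟨s * w, mul_mem hs hwn, 1, ?_⟩
      rw [hd, hw]; linear_combination w * hv

end chain

end PartA

section PartB
open nonZeroDivisors

/-- The divisibility form of FP-injectivity over chain rings. -/
def DivMod (V M : Type u) [CommRing V] [AddCommGroup M] [Module V M] : Prop :=
  ∀ (a : V) (m : M), (∀ c, c * a = 0 → c • m = 0) → ∃ y : M, a • y = m

section chainmod
variable {V : Type u} [CommRing V] {D M : Type u} [AddCommGroup D] [Module V D]
  [AddCommGroup M] [Module V M]

/-- A map vanishing on the kernel of `τ` factors through the range of `τ`. -/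
lemma factor_range {R A B C : Type*} [CommRing R] [AddCommGroup A] [Module R A]
    [AddCommGroup B] [Module R B] [AddCommGroup C] [Module R C] (τ : A →ₗ[R] B) (φ : A →ₗ[R] C)
    (h : ∀ x, τ x = 0 → φ x = 0) :
    ∃ ψ : LinearMap.range τ →ₗ[R] C, ∀ x, ψ ⟨τ x, ⟨x, rfl⟩⟩ = φ x := by
  refine ⟨(Submodule.liftQ (LinearMap.ker τ) φ (fun x hx => h x (LinearMap.mem_ker.1 hx))) ∘ₗ
    τ.quotKerEquivRange.symm.toLinearMap, fun x => ?_⟩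
  have : (⟨τ x, ⟨x, rfl⟩⟩ : LinearMap.range τ) =
      τ.quotKerEquivRange (Submodule.Quotient.mk x) := rfl
  rw [this, LinearMap.comp_apply, LinearEquiv.coe_coe, LinearEquiv.symm_apply_apply]
  rfl

/-- If a module has the extension property for principal ideals, it is `DivMod`. -/
lemma divMod_of_ext (h : ∀ (a : V) (f : Ideal.span {a} →ₗ[V] M),
    ∃ g : V →ₗ[V] M, ∀ x : Ideal.span {a}, g x = f x) : DivMod V M := by
  intro a m hm
  have hker : ∀ c, (LinearMap.toSpanSingleton V V a) c = 0 → c • m = 0 := by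
    intro c hc; exact hm c (by simpa using hc)
  let φ : V →ₗ[V] M := LinearMap.toSpanSingleton V M m
  let τ : V →ₗ[V] V := LinearMap.toSpanSingleton V V a
  have hr : LinearMap.range τ = Ideal.span {a} := by
    rw [LinearMap.range_toSpanSingleton]
  obtain ⟨ψ, hψ⟩ := factor_range τ φ (fun c hc => hker c hc)
  obtain ⟨g, hg⟩ := h a (ψ ∘ₗ (LinearEquiv.ofEq _ _ hr.symm).toLinearMap)
  refine ⟨g 1, ?_⟩
  have h1 := hg ⟨a, Ideal.subset_span rfl⟩
  have h2 : (LinearEquiv.ofEq _ _ hr.symm) ⟨a, Ideal.subset_span rfl⟩ =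
      (⟨τ 1, ⟨1, rfl⟩⟩ : LinearMap.range τ) := by
    apply Subtype.ext
    simp [τ]
  have h3 : g a = m := by
    rw [h1]
    change ψ ((LinearEquiv.ofEq _ _ hr.symm) _) = m
    rw [h2, hψ]
    simp [φ]
  rw [← h3, ← map_smul]; simp

lemma divMod_of_injective (h : Module.Injective V M) : DivMod V M := by
  apply divMod_of_ext
  intro a f
  obtain ⟨g, hg⟩ := h.out (Submodule.subtype _) (Submodule.subtype_injective _) f
  exact ⟨g, fun x => hg x⟩

variable (hV : ∀ a b : V, a ∣ b ∨ b ∣ a) (S : Submonoid V) (f : D →ₗ[V] M) [IsLocalizedModule S f]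
include hV

include S f in
lemma chain_divMod (hD : DivMod V D)
    (hgood : (∀ a b : V, a ≠ 0 → b ≠ 0 → a * b = 0 → (∀ c, c * a = 0 → InSat b c) →
      ∀ s ∈ V⁰, IsUnit s)) : DivMod V M := by
  intro a m hm
  obtain ⟨⟨x, u⟩, hx⟩ := IsLocalizedModule.surj S f m
  simp only at hx
  have hu : ∀ (s : S) (z z' : M), s • z = s • z' → z = z' := fun s z z' h =>
    IsLocalizedModule.smul_injective f s h
  have hz : ∀ z : D, f z = 0 → ∃ s ∈ S, s • z = 0 := by
    intro z hz
    rw [IsLocalizedModule.eq_zero_iff S f] at hz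
    obtain ⟨c, hc⟩ := hz
    exact ⟨c, c.2, hc⟩
  -- it suffices to solve for a multiple of `x`
  have key : ∀ t ∈ S, (∃ y, a • y = t • x) → ∃ y : M, a • y = m := by
    rintro t ht ⟨y, hy⟩
    obtain ⟨y', hy'⟩ := (Module.End.isUnit_iff _).1 (IsLocalizedModule.map_units f (⟨t, ht⟩ * u)) |>.2 (f y)
    refine ⟨y', hu (⟨t, ht⟩ * u) _ _ ?_⟩
    have h1 : ((t * u : V)) • y' = f y := hy'
    change (t * u : V) • (a • y') = (t * u : V) • m
    rw [smul_comm, h1, ← map_smul, hy, map_smul, mul_smul]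
    congr 1
    exact hx.symm
  -- `c` is in the saturation of `ann x`
  have hB : ∀ c, c * a = 0 → ∃ s ∈ S, (s * c) • x = 0 := by
    intro c hc
    obtain ⟨s, hs, h⟩ := hz (c • x) (by
      rw [map_smul, ← hx, smul_comm, hm c hc, smul_zero])
    exact ⟨s, hs, by rw [mul_smul]; exact h⟩
  by_cases hc : ∃ c, (∃ s ∈ S, (s * c) • x = 0) ∧ c * a ≠ 0
  · obtain ⟨c, ⟨t, ht, htc⟩, hca⟩ := hc
    apply key t ht
    apply hD
    intro b hb
    rcases hV c b with ⟨k, rfl⟩ | ⟨k, rfl⟩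
    · rw [smul_smul, show c * k * t = k * (t * c) by ring, mul_smul, htc, smul_zero]
    · exact absurd (by linear_combination k * hb) hca
  push Not at hc
  by_cases hBA : ∀ b, b * a = 0 → b • x = 0
  · exact key 1 (one_mem _) (by simpa using hD a x hBA)
  push Not at hBA
  obtain ⟨b, hb, hbx⟩ := hBA
  by_cases ha : a = 0
  · obtain ⟨s, hs, h⟩ := hB 1 (by simp [ha])
    exact key s hs ⟨0, by simpa using h.symm⟩
  have hS : ∀ s ∈ S, s ∈ V⁰ := by
    intro s hs
    by_contra hsn
    obtain ⟨y, hy1, hy2⟩ := chain_L hV hsn ha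
    obtain ⟨t, ht, h⟩ := hB (y * s) (by linear_combination hy1)
    exact hy2 (hc y ⟨t * s, mul_mem ht hs, by rw [← h]; congr 1; ring⟩)
  exfalso
  have hb0 : b ≠ 0 := by rintro rfl; simp at hbx
  have := hgood a b ha hb0 (by linear_combination hb) (by
    intro c hc
    obtain ⟨t, ht, h⟩ := hB c hc
    refine ⟨t, hS t ht, ?_⟩
    rcases hV b (t * c) with h1 | ⟨k, hk⟩
    · exact h1
    · exact absurd (by rw [hk, mul_comm, mul_smul, h, smul_zero]) hbx)
  obtain ⟨s, hs, h⟩ := hB b hb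
  have hsu := this s (hS s hs)
  apply hbx
  rw [mul_smul] at h
  exact hsu.smul_left_cancel.1 (by rw [h, smul_zero])

include S f in
lemma chain_injective (hD : Module.Injective V D) (hM : DivMod V M) : Module.Injective V M := by
  have hDd := divMod_of_injective hD
  have hu : ∀ (s : V) (_ : s ∈ S) (z z' : M), s • z = s • z' → z = z' := fun s hs z z' h =>
    IsLocalizedModule.smul_injective f ⟨s, hs⟩ h
  have hz : ∀ z : D, f z = 0 → ∃ s ∈ S, s • z = 0 := by
    intro z hz
    rw [IsLocalizedModule.eq_zero_iff S f] at hz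
    obtain ⟨c, hc⟩ := hz
    exact ⟨c, c.2, hc⟩
  apply Module.Baer.injective
  intro I g
  -- multiples
  have hgd : ∀ (g : I →ₗ[V] M) (r : I), ∃ z : M, (r : V) • z = g r := by
    intro g r
    apply hM
    intro c hc
    rw [← map_smul]
    rw [show c • r = 0 from Subtype.ext (by simpa using hc), map_zero]
  by_cases hq : ∃ r : I, ∀ r' : I, ¬ ∃ y : V, (r : V) = r' * y ∧ ∀ s ∈ S, s ∣ y
  · -- locally principal
    obtain ⟨r, hr⟩ := hq
    obtain ⟨z, hzr⟩ := hgd g r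
    refine ⟨LinearMap.toSpanSingleton V M z, ?_⟩
    intro c hc
    have : ∃ s ∈ S, ∃ t : V, s * c = r * t := by
      rcases hV r c with ⟨k, hk⟩ | ⟨d, hd⟩
      · exact ⟨1, one_mem _, k, by simpa using hk⟩
      · have := hr ⟨c, hc⟩
        push Not at this
        obtain ⟨s, hs, hsd⟩ := this d hd
        rcases hV s d with h | ⟨t, ht⟩
        · exact absurd h hsd
        · exact ⟨s, hs, t, by rw [hd, ht]; ring⟩
    obtain ⟨s, hs, t, hst⟩ := this
    apply hu s hs
    rw [LinearMap.toSpanSingleton_apply, smul_smul, hst, mul_comm, mul_smul, hzr, ← map_smul,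
      ← map_smul]
    congr 1
    apply Subtype.ext
    simp only [Submodule.coe_smul, smul_eq_mul]
    rw [hst, mul_comm]
  push Not at hq
  by_cases hg0 : ∀ r, g r = 0
  · exact ⟨0, fun c hc => by rw [hg0]; rfl⟩
  push Not at hg0
  obtain ⟨r0, hr0⟩ := hg0
  obtain ⟨z0, hz0⟩ := hgd g r0
  let g' : I →ₗ[V] M := g - (LinearMap.toSpanSingleton V M z0) ∘ₗ (Submodule.subtype I)
  have hg'0 : g' r0 = 0 := by simp [g', hz0]
  have hr0s : ∀ s ∈ S, s * (r0 : V) ≠ 0 := by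
    intro s hs h0
    apply hr0
    apply hu s hs
    rw [← map_smul, show s • r0 = 0 from Subtype.ext (by simpa using h0)]; simp
  -- lifting
  have lift : ∀ z : M, (r0 : V) • z = 0 → ∃ x : D, f x = z := by
    intro z hz1
    obtain ⟨⟨x, u⟩, hx⟩ := IsLocalizedModule.surj S f z
    have hx : (u : V) • z = f x := hx
    obtain ⟨s, hs, h⟩ := hz ((r0 : V) • x) (by rw [map_smul, ← hx, smul_comm, hz1, smul_zero])
    obtain ⟨v, hv⟩ := hDd (s * u) (s • x) (by
      intro c hc
      rcases hV (r0 : V) c with ⟨k, rfl⟩ | ⟨k, hk⟩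
      · rw [mul_comm, mul_smul, smul_comm (r0 : V) s x, h, smul_zero]
      · exact absurd (by rw [hk]; linear_combination k * hc) (hr0s (s * u) (mul_mem hs u.2)))
    refine ⟨v, hu (s * u) (mul_mem hs u.2) _ _ ?_⟩
    rw [← map_smul, hv, map_smul, mul_smul, hx]
  -- the relation
  let Rel : I → D → Prop := fun r d => ∃ (r' : I) (y : V) (x : D),
    (r : V) = r' * y ∧ (∀ s ∈ S, s ∣ y) ∧ (r' : V) • f x = g' r' ∧ d = (r : V) • x
  have hex : ∀ r, ∃ d, Rel r d := by
    intro r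
    obtain ⟨r', y, hy, hys⟩ := hq r
    obtain ⟨z, hzr⟩ := hgd g' r'
    rcases hV (r0 : V) r' with ⟨t, ht⟩ | ⟨t, ht⟩
    · refine ⟨0, r0, t * y, 0, by rw [hy, ht, mul_assoc], fun s hs => (hys s hs).mul_left _, ?_, ?_⟩
      · simp [hg'0]
      · simp
    · obtain ⟨x, rfl⟩ := lift z (by
        rw [ht, mul_comm, mul_smul, hzr, ← map_smul, ← hg'0]
        congr 1; apply Subtype.ext; simp [ht, mul_comm])
      exact ⟨_, r', y, x, hy, hys, hzr, rfl⟩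
  have aux : ∀ (r r' r'' : I) (y : V) (x' x'' : D), (r : V) = r'' * y → (∀ s ∈ S, s ∣ y) →
      (r' : V) ∣ r'' → (r' : V) • f x' = g' r' → (r'' : V) • f x'' = g' r'' →
      (r : V) • x' = (r : V) • x'' := by
    rintro r r' r'' y x' x'' hy hys ⟨t, ht⟩ h' h''
    have h1 : (r'' : V) • f x' = g' r'' := by
      rw [ht, mul_comm, mul_smul, h', ← map_smul]
      congr 1; apply Subtype.ext; simp [ht, mul_comm]
    obtain ⟨s, hs, h⟩ := hz ((r'' : V) • (x' - x'')) (by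
      rw [map_smul, map_sub, smul_sub, h1, h'', sub_self])
    obtain ⟨k, rfl⟩ := hys s hs
    rw [← sub_eq_zero, ← smul_sub, hy, show (r'' : V) * (s * k) = k * (s * r'') by ring, mul_smul,
      mul_smul, h, smul_zero]
  have huniq : ∀ r d d', Rel r d → Rel r d' → d = d' := by
    rintro r _ _ ⟨r', y, x, h1, h2, h3, rfl⟩ ⟨s', w, v, k1, k2, k3, rfl⟩
    rcases hV (r' : V) s' with h | h
    · exact aux r r' s' w x v k1 k2 h h3 k3
    · exact (aux r s' r' y v x h1 h2 h k3 h3).symm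
  choose φ hφ using hex
  have hadd : ∀ a b, φ (a + b) = φ a + φ b := by
    intro a b
    apply huniq (a + b) _ _ (hφ _)
    obtain ⟨r', y, x, h1, h2, h3, h4⟩ := hφ a
    obtain ⟨s', w, v, k1, k2, k3, k4⟩ := hφ b
    rw [h4, k4]
    rcases hV (r' : V) s' with h | h
    · refine ⟨r', ?_⟩
      have : (b : V) • v = (b : V) • x := (aux b r' s' w x v k1 k2 h h3 k3).symm
      obtain ⟨t, ht⟩ := h
      refine ⟨y + t * w, x, by simp [h1, k1, ht]; ring,
        fun s hs => dvd_add (h2 s hs) ((k2 s hs).mul_left _), h3, ?_⟩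
      rw [this, Submodule.coe_add, add_smul]
    · refine ⟨s', ?_⟩
      have : (a : V) • x = (a : V) • v := (aux a s' r' y v x h1 h2 h k3 h3).symm
      obtain ⟨t, ht⟩ := h
      refine ⟨w + t * y, v, by simp [h1, k1, ht]; ring,
        fun s hs => dvd_add (k2 s hs) ((h2 s hs).mul_left _), k3, ?_⟩
      rw [this, Submodule.coe_add, add_smul]
  have hsmul : ∀ (c : V) a, φ (c • a) = c • φ a := by
    intro c a
    apply huniq (c • a) _ _ (hφ _)
    obtain ⟨r', y, x, h1, h2, h3, h4⟩ := hφ a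
    refine ⟨r', c * y, x, by simp [h1]; ring, fun s hs => (h2 s hs).mul_left _, h3, ?_⟩
    rw [h4, Submodule.coe_smul, smul_eq_mul, mul_smul]
  let Φ : I →ₗ[V] D := { toFun := φ, map_add' := hadd, map_smul' := hsmul }
  obtain ⟨Ψ, hΨ⟩ := hD.out (Submodule.subtype I) (Submodule.subtype_injective _) Φ
  refine ⟨LinearMap.toSpanSingleton V M (f (Ψ 1) + z0), ?_⟩
  intro r hr
  have h1 : r • Ψ 1 = φ ⟨r, hr⟩ := by
    rw [← map_smul, smul_eq_mul, mul_one]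
    exact hΨ ⟨r, hr⟩
  have h2 : f (φ ⟨r, hr⟩) = g' ⟨r, hr⟩ := by
    obtain ⟨r', y, x, h1, h2, h3, h4⟩ := hφ ⟨r, hr⟩
    rw [h4, map_smul, h1, mul_comm, mul_smul, h3, ← map_smul]
    congr 1; apply Subtype.ext; simp only [Submodule.coe_smul, smul_eq_mul]
    rw [mul_comm, ← h1]
  rw [LinearMap.toSpanSingleton_apply, smul_add, ← map_smul, h1, h2]
  simp [g']

end chainmod

end PartB

section PartC
open nonZeroDivisors

lemma exists_inj_embedding (R : Type u) [CommRing R] (M : Type u) [AddCommGroup M] [Module R M] :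
    ∃ (E : ModuleCat.{u} R) (i : M →ₗ[R] E), Module.Injective R E ∧ Function.Injective i := by
  let J := CategoryTheory.Injective.under (ModuleCat.of R M)
  refine ⟨J, (CategoryTheory.Injective.ι (ModuleCat.of R M)).hom, ?_, ?_⟩
  · rw [Module.injective_iff_injective_object]
    exact CategoryTheory.Injective.injective_under _
  · exact (ModuleCat.mono_iff_injective _).1 inferInstance

section
variable {V : Type u} [CommRing V] 

lemma ann_fg_of_coherent (h : IsCoherentRing V) (a : V) :
    (LinearMap.ker (LinearMap.toSpanSingleton V V a)).FG := by
  have := h (LinearMap.range (LinearMap.toSpanSingleton V V a)) (by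
    rw [LinearMap.range_toSpanSingleton]; exact Submodule.fg_span_singleton a)
  have h2 := Module.FinitePresentation.fg_ker (LinearMap.rangeRestrict (LinearMap.toSpanSingleton V V a))
    (LinearMap.surjective_rangeRestrict _)
  rwa [LinearMap.ker_rangeRestrict] at h2

variable (hV : ∀ a b : V, a ∣ b ∨ b ∣ a)
include hV

lemma chain_principal (I : Ideal V) (hI : I.FG) : ∃ g, I = Ideal.span {g} := by
  have : IsBezout V := by
    rw [IsBezout.iff_span_pair_isPrincipal]
    intro x y
    rcases hV x y with ⟨k, rfl⟩ | ⟨k, rfl⟩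
    · refine ⟨x, ?_⟩
      rw [Ideal.span_insert]
      apply sup_eq_left.2
      rw [Ideal.span_singleton_le_span_singleton]; exact dvd_mul_right _ _
    · refine ⟨y, ?_⟩
      rw [Ideal.span_insert]
      apply sup_eq_right.2
      rw [Ideal.span_singleton_le_span_singleton]; exact dvd_mul_right _ _
  obtain ⟨g, hg⟩ := IsBezout.isPrincipal_of_FG I hI
  exact ⟨g, hg⟩

lemma exists_ann_not_fg (h : ¬ IsCoherentRing V) :
    ∃ a : V, ¬ (LinearMap.ker (LinearMap.toSpanSingleton V V a)).FG := by
  by_contra hn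
  push Not at hn
  apply h
  intro I hI
  obtain ⟨g, rfl⟩ := chain_principal hV I hI
  have h1 : LinearMap.range (LinearMap.toSpanSingleton V V g) = Ideal.span {g} := by
    rw [LinearMap.range_toSpanSingleton]
  rw [← h1]
  refine Module.finitePresentation_of_surjective
    (LinearMap.rangeRestrict (LinearMap.toSpanSingleton V V g)) (LinearMap.surjective_rangeRestrict _) ?_
  rw [LinearMap.ker_rangeRestrict]
  exact hn g

lemma SC_of_semicoherent (h : IsSemicoherentRing V) : SCProp V := by
  intro a
  by_cases hnon : ∀ x : V, x = 0
  · exact ⟨0, by simp, fun c _ => ⟨1, one_mem _, 0, by rw [hnon (1 * c)]; simp⟩⟩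
  push Not at hnon
  obtain ⟨E, i, hE, hi⟩ := exists_inj_embedding V V
  obtain ⟨F, j, hF, hj⟩ := exists_inj_embedding V
    (E ⧸ LinearMap.range (LinearMap.lsmul V E a))
  obtain ⟨G, hG, φ, hφ⟩ := h E F hE hF
  let x : E →ₗ[V] F := j ∘ₗ Submodule.mkQ _
  have hax : a • φ x = 0 := by
    rw [← map_smul]
    have : a • x = 0 := by
      ext e
      simp only [x, LinearMap.smul_apply, LinearMap.comp_apply, LinearMap.zero_apply]
      rw [← map_smul, ← map_smul]
      have : (Submodule.mkQ (LinearMap.range (LinearMap.lsmul V E a))) (a • e) = 0 := by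
        rw [Submodule.mkQ_apply, Submodule.Quotient.mk_eq_zero]
        exact ⟨e, rfl⟩
      rw [this, map_zero]
    rw [this, map_zero]
  have htriv := Module.Flat.isTrivialRelation_of_sum_smul_eq_zero (R := V) (M := G)
    (ι := Unit) (f := fun _ => a) (x := fun _ => φ x) (by simpa using hax)
  obtain ⟨k, A, y, h1, h2⟩ := htriv
  -- all the `A () j` are multiples of a single element
  have hcomm : ∀ (s : Finset (Fin k)), ∃ b : V, b * a = 0 ∧ ∀ j ∈ s, b ∣ A () j := by
    intro s
    induction s using Finset.induction_on with
    | empty => exact ⟨0, by simp, by simp⟩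
    | insert j s hjs ih =>
      obtain ⟨b, hb, hbs⟩ := ih
      rcases hV b (A () j) with h | h
      · refine ⟨b, hb, fun j' hj' => ?_⟩
        rcases Finset.mem_insert.1 hj' with rfl | h'
        · exact h
        · exact hbs _ h'
      · refine ⟨A () j, by simpa [mul_comm] using h2 j, fun j' hj' => ?_⟩
        rcases Finset.mem_insert.1 hj' with rfl | h'
        · exact dvd_rfl
        · exact h.trans (hbs _ h')
  obtain ⟨b, hb, hbs⟩ := hcomm Finset.univ
  refine ⟨b, hb, ?_⟩
  intro c hc
  have hcx : c • x = 0 := by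
    apply hφ
    rw [map_smul, map_zero, (show φ x = ∑ j, A () j • y j from h1 ()), Finset.smul_sum]
    apply Finset.sum_eq_zero
    intro j _
    obtain ⟨m, hm⟩ := hbs j (Finset.mem_univ _)
    rw [smul_smul, hm, ← mul_assoc, hc, zero_mul, zero_smul]
  by_contra hns
  obtain ⟨d, hd, had⟩ := chain_notSat hV hns
  by_cases hc0 : c = 0
  · exact hns ⟨1, one_mem _, by simp [hc0]⟩
  obtain ⟨y, hy1, hy2⟩ := chain_L hV hd hc0
  have hmem : c • i 1 ∈ LinearMap.range (LinearMap.lsmul V E a) := by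
    rw [← Submodule.Quotient.mk_eq_zero, ← Submodule.mkQ_apply]
    apply hj
    rw [map_zero, map_smul, map_smul]
    exact LinearMap.congr_fun hcx (i 1)
  obtain ⟨e, he⟩ := hmem
  apply hy2
  apply hi
  have he : a • e = c • i 1 := he
  rw [map_zero, show y * c = y • c • (1 : V) by simp, map_smul, map_smul, ← he, smul_smul,
    show y * a = 0 by rw [had]; linear_combination hy1, zero_smul]

lemma chain_flat (G : Type u) [AddCommGroup G] [Module V G]
    (h : ∀ (a : V) (g : G), a • g = 0 → ∃ b y, b * a = 0 ∧ g = b • y) : Module.Flat V G := by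
  rw [Module.Flat.iff_rTensor_injective]
  intro I hI
  obtain ⟨a, rfl⟩ := chain_principal hV I hI
  rw [injective_iff_map_eq_zero]
  let a' : Ideal.span {a} := ⟨a, Ideal.subset_span rfl⟩
  have hz1 : ∀ z, ∃ g : G, z = a' ⊗ₜ[V] g := by
    intro z
    induction z using TensorProduct.induction_on with
    | zero => exact ⟨0, by simp⟩
    | tmul x y => 
      obtain ⟨x, hx⟩ := x
      obtain ⟨k, rfl⟩ := Ideal.mem_span_singleton.1 hx
      refine ⟨k • y, ?_⟩
      rw [← TensorProduct.smul_tmul]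
      congr 1
      exact Subtype.ext (mul_comm _ _)
    | add x y hx hy =>
      obtain ⟨g, rfl⟩ := hx
      obtain ⟨g', rfl⟩ := hy
      exact ⟨g + g', (TensorProduct.tmul_add _ _ _).symm⟩
  intro z hz
  obtain ⟨g, rfl⟩ := hz1 z
  have h0 : a • g = 0 := by
    have := congrArg (TensorProduct.lid V G) hz
    simpa [a'] using this
  obtain ⟨b, y, hb, rfl⟩ := h a g h0
  rw [← TensorProduct.smul_tmul, show b • a' = 0 from Subtype.ext hb, TensorProduct.zero_tmul]

lemma semicoherent_of_SC (h : SCProp V) : IsSemicoherentRing V := by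
  intro E F _ _ _ _ hE hF
  let Q := Localization V⁰
  let H := E →ₗ[V] F
  obtain ⟨G, i, hG, hi⟩ := exists_inj_embedding Q (LocalizedModule V⁰ H)
  let : Module V G := Module.compHom G (algebraMap V Q)
  have : IsScalarTower V Q G := ⟨fun a q g => by rw [Algebra.smul_def, mul_smul]; rfl⟩
  refine ⟨ModuleCat.of V G, ?_, (i.restrictScalars V) ∘ₗ LocalizedModule.mkLinearMap V⁰ H, ?_⟩
  · apply chain_flat hV
    intro a g hag
    obtain ⟨b, hb, hb'⟩ := h a
    obtain ⟨y, hy⟩ := divMod_of_injective hG (algebraMap V Q b) g (by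
      intro q hq
      obtain ⟨⟨c, s⟩, hcs⟩ := IsLocalization.surj V⁰ q
      have hc0 : c * b = 0 := by
        apply IsLocalization.injective Q (le_refl V⁰)
        simp only at hcs
        rw [map_mul, ← hcs, map_zero]; linear_combination (algebraMap V Q s) * hq
      obtain ⟨t, ht, k, hk⟩ := hb' c hc0
      have h1 : (algebraMap V Q t * algebraMap V Q s) • q • g = 0 := by
        rw [smul_smul, mul_assoc, mul_comm _ q, hcs, ← map_mul, hk, mul_comm a, map_mul, mul_smul]
        rw [show algebraMap V Q a • g = 0 from hag, smul_zero]
      have hu : IsUnit (algebraMap V Q t * algebraMap V Q s) :=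
        (IsLocalization.map_units Q ⟨t, ht⟩).mul (IsLocalization.map_units Q s)
      exact hu.smul_left_cancel.1 (by rw [h1, smul_zero]))
    exact ⟨b, y, hb, hy.symm⟩
  · have h1 : Function.Injective (LocalizedModule.mkLinearMap V⁰ H) := by
      rw [injective_iff_map_eq_zero]
      intro x hx
      rw [IsLocalizedModule.eq_zero_iff V⁰ (LocalizedModule.mkLinearMap V⁰ H)] at hx
      obtain ⟨s, hs⟩ := hx
      ext e
      obtain ⟨e', rfl⟩ := divMod_of_injective hE (s : V) e (by
        intro c hc
        have hc0 : c = 0 := nzd_cancel s.2 (by rw [mul_comm]; exact hc)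
        rw [hc0, zero_smul])
      rw [map_smul]
      exact LinearMap.congr_fun hs e'
    exact hi.comp h1

lemma good_of_coherent_or (h : IsCoherentRing V ∨ ¬ IsSemicoherentRing V) :
    ∀ a b : V, a ≠ 0 → b ≠ 0 → a * b = 0 → (∀ c, c * a = 0 → InSat b c) →
      ∀ s ∈ V⁰, IsUnit s := by
  intro a b ha hb hab hc s hs
  rcases h with h | h
  · obtain ⟨g, hg⟩ := chain_principal hV _ (ann_fg_of_coherent h a)
    have hmem : ∀ c, c * a = 0 ↔ g ∣ c := by
      intro c
      rw [← Ideal.mem_span_singleton, ← hg]; simp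
    rcases hV s g with ⟨g', hg'⟩ | ⟨k, hk⟩
    · have h1 : g' * a = 0 := nzd_cancel hs (by
        have := (hmem g).2 dvd_rfl
        rw [hg'] at this; linear_combination this)
      obtain ⟨h', hh⟩ := (hmem _).1 h1
      rcases chain_unit hV (s * h') with hu | hu
      · exact isUnit_of_mul_isUnit_left hu
      · exfalso
        have : g * (1 - s * h') = 0 := by linear_combination hg' + s * hh
        have hg0 := hu.mul_left_eq_zero.1 this
        obtain ⟨m, hm⟩ := (hmem b).1 (by linear_combination hab)
        apply hb; rw [hm, hg0, zero_mul]
    · exfalso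
      apply ha
      apply nzd_cancel hs
      rw [(hmem s).2 ⟨k, hk⟩]
  · exact absurd (semicoherent_of_SC hV (chain_SC_of_pair hV ha hb hab hc)) h

lemma bad_pair (h : IsSemicoherentRing V) (hc : ¬ IsCoherentRing V) :
    ∃ a b s : V, a ≠ 0 ∧ b ≠ 0 ∧ a * b = 0 ∧ (∀ c, c * a = 0 → InSat b c) ∧ s ∈ V⁰ ∧ ¬ IsUnit s := by
  obtain ⟨a, ha⟩ := exists_ann_not_fg hV hc
  obtain ⟨b, hb, hbs⟩ := SC_of_semicoherent hV h a
  have ha0 : a ≠ 0 := by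
    rintro rfl
    apply ha
    rw [show LinearMap.ker (LinearMap.toSpanSingleton V V 0) = Ideal.span {1} by ext; simp]
    exact Submodule.fg_span_singleton _
  have hb0 : b ≠ 0 := by
    rintro rfl
    obtain ⟨s, hs, k, hk⟩ := hbs 1 (by simp)
    apply ha
    rw [show LinearMap.ker (LinearMap.toSpanSingleton V V a) = ⊥ by
      rw [LinearMap.ker_eq_bot']
      intro m hm
      simp at hm
      exact nzd_cancel hs (by linear_combination m * hk + k * hm)]
    exact Submodule.fg_bot
  have hsat := chain_DA hV hb0 hbs
  refine ⟨a, b, ?_⟩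
  by_contra hn
  push Not at hn
  have hu := fun s => hn s ha0 hb0 (by linear_combination hb) hsat
  apply ha
  rw [show LinearMap.ker (LinearMap.toSpanSingleton V V a) = Ideal.span {b} by
    ext c
    rw [Ideal.mem_span_singleton]
    constructor
    · intro hc
      obtain ⟨s, hs, hk⟩ := hsat c (by simpa using hc)
      exact (hu s hs).dvd_mul_left.1 hk
    · rintro ⟨k, rfl⟩
      simp; linear_combination k * hb]
  exact Submodule.fg_span_singleton _
end

end PartC

section PartD
open CategoryTheory

lemma ext_subsingleton_iff (R : Type u) [CommRing R] (X Y : ModuleCat.{u} R)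
    (P : ProjectiveResolution X) :
    Subsingleton (((Ext R (ModuleCat.{u} R) 1).obj (Opposite.op X)).obj Y) ↔
      ∀ φ : P.complex.X 1 ⟶ Y, P.complex.d 2 1 ≫ φ = 0 →
        ∃ ψ : P.complex.X 0 ⟶ Y, P.complex.d 1 0 ≫ ψ = φ := by
  rw [← ModuleCat.isZero_iff_subsingleton, (P.isoExt (R := R) 1 Y).isZero_iff,
    ← HomologicalComplex.exactAt_iff_isZero_homology,
    HomologicalComplex.exactAt_iff' _ 0 1 2 (by simp) (by simp),
    ShortComplex.moduleCat_exact_iff]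
  exact Iff.rfl

/-- Every map from the kernel of `π` to `E` extends. -/
def KerExt {R P F : Type*} [CommRing R] [AddCommGroup P] [Module R P]
    [AddCommGroup F] [Module R F] (π : P →ₗ[R] F) (E : Type*) [AddCommGroup E] [Module R E] : Prop :=
  ∀ h : LinearMap.ker π →ₗ[R] E, ∃ g : P →ₗ[R] E, ∀ x : LinearMap.ker π, g x = h x

lemma kerExt_transfer {R P P' F E : Type*} [CommRing R] [AddCommGroup P] [Module R P]
    [AddCommGroup P'] [Module R P'] [AddCommGroup F] [Module R F] [AddCommGroup E] [Module R E]
    [Module.Projective R P] [Module.Projective R P'] (π : P →ₗ[R] F) (π' : P' →ₗ[R] F)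
    (hπ : Function.Surjective π) (hπ' : Function.Surjective π') (h : KerExt π E) : KerExt π' E := by
  intro k
  obtain ⟨α, hα⟩ := Module.projective_lifting_property π π' hπ
  obtain ⟨β, hβ⟩ := Module.projective_lifting_property π' π hπ'
  have hα' : ∀ x, π (α x) = π' x := fun x => LinearMap.congr_fun hα x
  have hβ' : ∀ x, π' (β x) = π x := fun x => LinearMap.congr_fun hβ x
  obtain ⟨ψ, hψ⟩ := h (k ∘ₗ (LinearMap.restrict β (p := LinearMap.ker π) (q := LinearMap.ker π')
    (by intro x hx; rw [LinearMap.mem_ker] at *; rw [hβ', hx])))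
  refine ⟨ψ ∘ₗ α + k ∘ₗ (LinearMap.codRestrict (LinearMap.ker π') (LinearMap.id - β ∘ₗ α)
    (by intro x; simp [hα', hβ'])), ?_⟩
  rintro ⟨x, hx⟩
  have h1 := hψ ⟨α x, by rw [LinearMap.mem_ker] at *; rw [hα', hx]⟩
  simp only [LinearMap.add_apply, LinearMap.comp_apply]
  simp only at h1
  rw [h1, LinearMap.comp_apply, ← map_add]
  congr 1
  apply Subtype.ext
  simp

lemma ext_subsingleton_iff_kerExt (R : Type u) [CommRing R] (F E P : Type u) [AddCommGroup F]
    [Module R F] [AddCommGroup E] [Module R E] [AddCommGroup P] [Module R P]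
    [Module.Projective R P] (π : P →ₗ[R] F) (hπ : Function.Surjective π) :
    Subsingleton (((Ext R (ModuleCat.{u} R) 1).obj (Opposite.op (ModuleCat.of R F))).obj
      (ModuleCat.of R E)) ↔ KerExt π E := by
  let Q := ProjectiveResolution.of (ModuleCat.of R F)
  rw [ext_subsingleton_iff R _ _ Q]
  have : Module.Projective R (Q.complex.X 0) :=
    (IsProjective.iff_projective _).2 (Q.projective 0)
  obtain ⟨π', hs, hk⟩ : ∃ π' : (Q.complex.X 0) →ₗ[R] F, Function.Surjective π' ∧
      LinearMap.ker π' = LinearMap.range (Q.complex.d 1 0).hom := by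
    have h0 := (ShortComplex.moduleCat_exact_iff _).1 Q.exact₀
    have hep : Epi (Q.π.f 0) := inferInstance
    rw [ModuleCat.epi_iff_surjective] at hep
    let e := (HomologicalComplex.singleObjXSelf (ComplexShape.down ℕ) 0 (ModuleCat.of R F)).toLinearEquiv
    refine ⟨e.toLinearMap ∘ₗ (Q.π.f 0).hom, e.surjective.comp hep, ?_⟩
    ext x
    simp only [LinearMap.mem_ker, LinearMap.comp_apply, LinearEquiv.coe_coe,
      LinearEquiv.map_eq_zero_iff, LinearMap.mem_range]
    constructor
    · intro hx
      exact h0 x hx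
    · rintro ⟨y, rfl⟩
      have := Q.complex_d_comp_π_f_zero
      exact LinearMap.congr_fun (congrArg ModuleCat.Hom.hom this) y
  have hmid : KerExt π' E ↔ KerExt π E :=
    ⟨kerExt_transfer π' π hs hπ, kerExt_transfer π π' hπ hs⟩
  rw [← hmid]
  have h1 := (ShortComplex.moduleCat_exact_iff _).1 (Q.exact_succ 0)
  constructor
  · intro H h
    let d1 := LinearMap.codRestrict (LinearMap.ker π') (Q.complex.d 1 0).hom
      (by intro x; rw [hk]; exact ⟨x, rfl⟩)
    obtain ⟨ψ, hψ⟩ := H (ModuleCat.ofHom (h ∘ₗ d1)) (by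
      ext x
      have : d1 ((Q.complex.d 2 1).hom x) = 0 := by
        apply Subtype.ext
        exact LinearMap.congr_fun (congrArg ModuleCat.Hom.hom (Q.complex.d_comp_d 2 1 0)) x
      change h (d1 ((Q.complex.d 2 1).hom x)) = 0
      rw [this, map_zero])
    refine ⟨ψ.hom, ?_⟩
    rintro ⟨x, hx⟩
    have hx' := hx
    rw [hk] at hx'
    obtain ⟨y, rfl⟩ := hx'
    exact LinearMap.congr_fun (congrArg ModuleCat.Hom.hom hψ) y
  · intro H φ hφ
    obtain ⟨ψ0, hψ0⟩ := factor_range (Q.complex.d 1 0).hom φ.hom (by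
      intro x hx
      obtain ⟨y, rfl⟩ := h1 x hx
      exact LinearMap.congr_fun (congrArg ModuleCat.Hom.hom hφ) y)
    obtain ⟨g, hg⟩ := H (ψ0 ∘ₗ (LinearEquiv.ofEq _ _ hk).toLinearMap)
    refine ⟨ModuleCat.ofHom g, ?_⟩
    ext x
    have := hg ⟨(Q.complex.d 1 0).hom x, by rw [hk]; exact ⟨x, rfl⟩⟩
    rw [← hψ0 x]
    exact this

/-- Elementary form of FP-injectivity. -/
def FPI (R : Type u) [CommRing R] (E : Type u) [AddCommGroup E] [Module R E] : Prop :=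
  ∀ (n : ℕ) (K : Submodule R (Fin n → R)), K.FG → ∀ h : K →ₗ[R] E,
    ∃ g : (Fin n → R) →ₗ[R] E, ∀ x : K, g x = h x

lemma isFPInjective_iff (R : Type u) [CommRing R] (E : Type u) [AddCommGroup E] [Module R E] :
    IsFPInjective R E ↔ FPI R E := by
  constructor
  · intro H n K hK h
    have : Module.FinitePresentation R ((Fin n → R) ⧸ K) :=
      Module.finitePresentation_of_surjective K.mkQ K.mkQ_surjective (by rwa [K.ker_mkQ])
    obtain ⟨g, hg⟩ := (ext_subsingleton_iff_kerExt R _ E _ K.mkQ K.mkQ_surjective).1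
      (H ((Fin n → R) ⧸ K) inferInstance)
      (h ∘ₗ (LinearEquiv.ofEq _ _ K.ker_mkQ).toLinearMap)
    exact ⟨g, fun x => hg ⟨x, by rw [K.ker_mkQ]; exact x.2⟩⟩
  · intro H F _ _ hF
    obtain ⟨n, K, e, hfg⟩ := Module.FinitePresentation.exists_fin R F
    rw [ext_subsingleton_iff_kerExt R F E _ (e.symm.toLinearMap ∘ₗ K.mkQ)
      (e.symm.surjective.comp K.mkQ_surjective)]
    intro h
    refine H n _ ?_ h
    rw [LinearEquiv.ker_comp, K.ker_mkQ]
    exact hfg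

lemma FPI.of_equiv {R : Type u} [CommRing R] {E E' : Type u} [AddCommGroup E] [Module R E]
    [AddCommGroup E'] [Module R E'] (e : E ≃ₗ[R] E') (h : FPI R E) : FPI R E' := by
  intro n K hK k
  obtain ⟨g, hg⟩ := h n K hK (e.symm.toLinearMap ∘ₗ k)
  exact ⟨e.toLinearMap ∘ₗ g, fun x => by simp [hg]⟩

lemma FPI.of_injective {R : Type u} [CommRing R] {E : Type u} [AddCommGroup E] [Module R E]
    (h : Module.Injective R E) : FPI R E := by
  intro n K hK k
  obtain ⟨g, hg⟩ := h.out K.subtype K.injective_subtype k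
  exact ⟨g, fun x => hg x⟩

lemma FPI.divMod {R : Type u} [CommRing R] {E : Type u} [AddCommGroup E] [Module R E]
    (h : FPI R E) : DivMod R E := by
  intro a m hm
  let τ : R →ₗ[R] (Fin 1 → R) := LinearMap.toSpanSingleton R _ (fun _ => a)
  obtain ⟨ψ, hψ⟩ := factor_range τ (LinearMap.toSpanSingleton R E m) (by
    intro x hx
    have := congrFun hx 0
    exact hm x (by simpa [τ] using this))
  obtain ⟨g, hg⟩ := h 1 _ (by rw [LinearMap.range_toSpanSingleton]; exact Submodule.fg_span_singleton _) ψ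
  refine ⟨g (fun _ => 1), ?_⟩
  have h1 := hg ⟨τ 1, ⟨1, rfl⟩⟩
  rw [hψ] at h1
  simp only [LinearMap.toSpanSingleton_apply, one_smul] at h1
  rw [← h1, ← map_smul]
  congr 1
  ext i
  simp [τ]

end PartD

section PartE
section hulls
variable {R : Type u} [CommRing R]

/-- Elementwise form of essentiality. -/
def Ess {D : Type u} [AddCommGroup D] [Module R D] (A H : Submodule R D) : Prop :=
  ∀ x ∈ H, x ≠ 0 → ∃ r : R, r • x ∈ A ∧ r • x ≠ 0

lemma injective_of_retract {D H : Type u} [AddCommGroup D] [Module R D] [AddCommGroup H]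
    [Module R H] (i : H →ₗ[R] D) (p : D →ₗ[R] H) (hip : ∀ x, p (i x) = x)
    (hD : Module.Injective R D) : Module.Injective R H := by
  constructor
  intro X Y _ _ _ _ f hf g
  obtain ⟨h, hh⟩ := hD.out f hf (i ∘ₗ g)
  exact ⟨p ∘ₗ h, fun x => by simp [hh, hip]⟩

lemma injective_of_equiv {D H : Type u} [AddCommGroup D] [Module R D] [AddCommGroup H]
    [Module R H] (e : D ≃ₗ[R] H) (hD : Module.Injective R D) : Module.Injective R H :=
  injective_of_retract e.symm.toLinearMap e.toLinearMap (by simp) hD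

variable {D : Type u} [AddCommGroup D] [Module R D]

lemma exists_max_ess (A : Submodule R D) :
    ∃ H, A ≤ H ∧ Ess A H ∧ ∀ H', H ≤ H' → Ess A H' → H' ≤ H := by
  obtain ⟨H, hAH, hm⟩ := zorn_le_nonempty₀ {H : Submodule R D | Ess A H} (by
    intro c hc hchain y hy
    refine ⟨sSup c, ?_, fun z hz => le_sSup hz⟩
    intro x hx hx0
    rw [Submodule.mem_sSup_of_directed ⟨y, hy⟩ hchain.directedOn] at hx
    obtain ⟨z, hz, hxz⟩ := hx
    exact hc hz x hxz hx0) A (fun x hx hx0 => ⟨1, by simpa using hx, by simpa using hx0⟩)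
  exact ⟨H, hAH, hm.1, fun H' h1 h2 => hm.2 h2 h1⟩

lemma exists_max_disj (H : Submodule R D) :
    ∃ C : Submodule R D, H ⊓ C = ⊥ ∧ ∀ C', C ≤ C' → H ⊓ C' = ⊥ → C' ≤ C := by
  obtain ⟨C, -, hm⟩ := zorn_le_nonempty₀ {C : Submodule R D | H ⊓ C = ⊥} (by
    intro c hc hchain y hy
    refine ⟨sSup c, ?_, fun z hz => le_sSup hz⟩
    rw [Set.mem_ofPred_eq, eq_bot_iff]
    rintro x ⟨hx1, hx⟩
    have hx' : x ∈ sSup c := hx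
    rw [Submodule.mem_sSup_of_directed ⟨y, hy⟩ hchain.directedOn] at hx'
    obtain ⟨z, hz, hxz⟩ := hx'
    have h3 : H ⊓ z = ⊥ := hc hz
    rw [← h3]
    exact ⟨hx1, hxz⟩) ⊥ (by simp)
  exact ⟨C, hm.1, fun H' h1 h2 => hm.2 h2 h1⟩

lemma exists_hull_in (hD : Module.Injective R D) (A : Submodule R D) :
    ∃ H C : Submodule R D, A ≤ H ∧ Ess A H ∧ IsCompl H C := by
  obtain ⟨H, hAH, hess, hmax⟩ := exists_max_ess A
  obtain ⟨C, hC, hCmax⟩ := exists_max_disj H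
  refine ⟨H, C, hAH, hess, ?_⟩
  have hdis : ∀ x, x ∈ H → x ∈ C → x = 0 := by
    intro x h1 h2
    have : x ∈ H ⊓ C := ⟨h1, h2⟩
    rw [hC] at this
    simpa using this
  have hout : ∀ x, x ∉ C → ∃ r : R, ∃ c ∈ C, ∃ h ∈ H, h ≠ 0 ∧ h = c + r • x := by
    intro x hx
    by_contra hn
    push Not at hn
    apply hx
    apply hCmax (C ⊔ Submodule.span R {x}) le_sup_left
    · rw [eq_bot_iff]
      rintro h ⟨hh, hh2⟩
      obtain ⟨c, hc, y, hy, rfl⟩ := Submodule.mem_sup.1 hh2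
      obtain ⟨r, rfl⟩ := Submodule.mem_span_singleton.1 hy
      by_contra h0
      exact hn r c hc _ hh h0 rfl
    · exact Submodule.mem_sup_right (Submodule.mem_span_singleton_self x)
  obtain ⟨φ, hφ⟩ := hD.out (C.mkQ ∘ₗ H.subtype) (by
    rw [injective_iff_map_eq_zero]
    rintro ⟨x, hx⟩ h
    have : x ∈ C := by simpa using h
    exact Subtype.ext (hdis x hx this)) H.subtype
  have hφ' : ∀ x ∈ H, φ (C.mkQ x) = x := fun x hx => hφ ⟨x, hx⟩
  have hφC : ∀ x ∈ C, φ (C.mkQ x) = 0 := fun x hx => by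
    rw [Submodule.mkQ_apply, (Submodule.Quotient.mk_eq_zero C).2 hx, map_zero]
  have hinj : ∀ x, φ (C.mkQ x) = 0 → x ∈ C := by
    intro x hx
    by_contra hxC
    obtain ⟨r, c, hc, h, hh, h0, heq⟩ := hout x hxC
    apply h0
    rw [← hφ' h hh, heq, map_add, map_add, hφC c hc, map_smul, map_smul, hx, smul_zero, add_zero]
  have hle : LinearMap.range φ ≤ H := by
    apply hmax
    · intro x hx
      exact ⟨_, hφ' x hx⟩
    · rintro _ ⟨q, rfl⟩ hq0
      obtain ⟨x, rfl⟩ := C.mkQ_surjective q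
      have hxC : x ∉ C := fun h => hq0 (hφC x h)
      obtain ⟨r, c, hc, h, hh, h0, heq⟩ := hout x hxC
      obtain ⟨r', h1, h2⟩ := hess h hh h0
      have h3 : r • φ (C.mkQ x) = h := by
        rw [← hφ' h hh, heq, map_add, map_add, hφC c hc, map_smul, map_smul, zero_add]
      refine ⟨r' * r, ?_, ?_⟩
      · rwa [mul_smul, h3]
      · rwa [mul_smul, h3]
  constructor
  · rwa [disjoint_iff]
  · rw [codisjoint_iff, eq_top_iff]
    intro x _
    have h1 : φ (C.mkQ x) ∈ H := hle ⟨_, rfl⟩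
    have h2 : x - φ (C.mkQ x) ∈ C := by
      apply hinj
      rw [map_sub, map_sub, hφ' _ h1, sub_self]
    rw [← add_sub_cancel (φ (C.mkQ x)) x]
    exact Submodule.add_mem_sup h1 h2

lemma injective_of_isCompl (hD : Module.Injective R D) {H C : Submodule R D} (h : IsCompl H C) :
    Module.Injective R H := by
  refine injective_of_retract H.subtype (Submodule.projectionOnto H C h) ?_ hD
  intro x
  simp

lemma indec_uniform (hD : Module.Injective R D) (hi : IsIndecomposableModule R D)
    {x y : D} (hx : x ≠ 0) (hy : y ≠ 0) : ∃ r : R, r • x ≠ 0 ∧ r • x ∈ Submodule.span R {y} := by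
  obtain ⟨H, C, hle, hess, hc⟩ := exists_hull_in hD (Submodule.span R {y})
  rcases hi.2 H C hc with h | h
  · exfalso
    have := hle (Submodule.mem_span_singleton_self y)
    rw [h] at this
    exact hy (by simpa using this)
  · have hH : H = ⊤ := by
      have := hc.sup_eq_top
      rwa [h, sup_bot_eq] at this
    obtain ⟨r, h1, h2⟩ := hess x (by rw [hH]; trivial) hx
    exact ⟨r, h2, h1⟩

lemma exists_injectiveHull (R : Type u) [CommRing R] (M : Type u) [AddCommGroup M] [Module R M] :
    ∃ (E : ModuleCat.{u} R) (f : M →ₗ[R] E), IsInjectiveHull R M E f := by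
  obtain ⟨E, i, hE, hi⟩ := exists_inj_embedding R M
  obtain ⟨H, C, hle, hess, hc⟩ := exists_hull_in hE (LinearMap.range i)
  refine ⟨ModuleCat.of R H, LinearMap.codRestrict H i (fun x => hle ⟨x, rfl⟩),
    injective_of_isCompl hE hc, ?_, ?_⟩
  · intro x y hxy
    exact hi (congrArg Subtype.val hxy)
  · intro N hN hbot
    obtain ⟨x, hxN, hx0⟩ := Submodule.exists_mem_ne_zero_of_ne_bot hN
    obtain ⟨r, ⟨m, hm⟩, h2⟩ := hess x.1 x.2 (fun h => hx0 (Subtype.ext h))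
    have hmem : r • x ∈ N ⊓ LinearMap.range (LinearMap.codRestrict H i (fun x => hle ⟨x, rfl⟩)) :=
      ⟨N.smul_mem r hxN, m, Subtype.ext hm⟩
    rw [hbot] at hmem
    apply h2
    have : r • x = 0 := (Submodule.mem_bot R).1 hmem
    exact congrArg Subtype.val this

/-- The socle generator of `E(R/P)`. -/
lemma hull_mem {P : Ideal R} (hP : P.IsMaximal) {E : Type u} [AddCommGroup E] [Module R E]
    {f : (R ⧸ P) →ₗ[R] E} (hf : IsInjectiveHull R (R ⧸ P) E f) {x : E} (hx : x ≠ 0) :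
    ∃ r : R, r • x = f 1 := by
  have h := hf.2.2 (Submodule.span R {x}) (by simpa using hx)
  obtain ⟨y, ⟨hy1, ⟨q, hq⟩⟩, hy0⟩ := Submodule.exists_mem_ne_zero_of_ne_bot h
  obtain ⟨r, rfl⟩ := Submodule.mem_span_singleton.1 hy1
  have hq0 : q ≠ 0 := by
    rintro rfl
    exact hy0 (by rw [← hq, map_zero])
  let := Ideal.Quotient.field P
  obtain ⟨s, hs⟩ := Ideal.Quotient.mk_surjective q⁻¹
  refine ⟨s * r, ?_⟩
  rw [mul_smul, ← hq, ← map_smul]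
  congr 1
  rw [Algebra.smul_def]
  change Ideal.Quotient.mk P s * q = 1
  rw [hs, inv_mul_cancel₀ hq0]

lemma hull_one_ne {P : Ideal R} (hP : P.IsMaximal) {E : Type u} [AddCommGroup E] [Module R E]
    {f : (R ⧸ P) →ₗ[R] E} (hf : IsInjectiveHull R (R ⧸ P) E f) : f 1 ≠ 0 := by
  intro h
  have h1 : (1 : R ⧸ P) = 0 := hf.2.1 (by rw [h, map_zero])
  have : Nontrivial (R ⧸ P) := Ideal.Quotient.nontrivial_iff.2 hP.ne_top
  exact one_ne_zero h1

lemma hull_indec {P : Ideal R} (hP : P.IsMaximal) {E : Type u} [AddCommGroup E] [Module R E]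
    {f : (R ⧸ P) →ₗ[R] E} (hf : IsInjectiveHull R (R ⧸ P) E f) : IsIndecomposableModule R E := by
  have h1 := hull_one_ne hP hf
  refine ⟨⟨f 1, 0, h1⟩, ?_⟩
  intro A B hAB
  by_contra hn
  push Not at hn
  obtain ⟨a, ha, ha0⟩ := Submodule.exists_mem_ne_zero_of_ne_bot hn.1
  obtain ⟨b, hb, hb0⟩ := Submodule.exists_mem_ne_zero_of_ne_bot hn.2
  obtain ⟨r, hr⟩ := hull_mem hP hf ha0
  obtain ⟨s, hs⟩ := hull_mem hP hf hb0
  have hmem : f 1 ∈ A ⊓ B := ⟨by rw [← hr]; exact A.smul_mem _ ha, by rw [← hs]; exact B.smul_mem _ hb⟩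
  rw [hAB.inf_eq_bot] at hmem
  exact h1 (by simpa using hmem)

lemma goldie_of_indec (hD : Module.Injective R D) (hi : IsIndecomposableModule R D) :
    HasFiniteGoldieDimension R D := by
  refine ⟨ModuleCat.of R D, LinearMap.id, ⟨hD, Function.injective_id, ?_⟩, 1, fun _ => ⊤, ?_, ?_⟩
  · intro N hN
    simpa using hN
  · apply DirectSum.isInternal_submodule_of_iSupIndep_of_iSup_eq_top
    · intro i
      rw [show (⨆ j, ⨆ (_ : j ≠ i), (⊤ : Submodule R D)) = ⊥ by
        simp only [iSup_eq_bot]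
        intro j hj
        exact absurd (Subsingleton.elim j i) hj]
      exact disjoint_bot_right
    · simp
  · intro _
    refine ⟨injective_of_equiv Submodule.topEquiv.symm hD, ?_⟩
    let e : (⊤ : Submodule R D) ≃ₗ[R] D := Submodule.topEquiv
    obtain ⟨hnt, hAB⟩ := hi
    refine ⟨e.toEquiv.nontrivial, ?_⟩
    intro A B h
    have h2 := hAB (A.map e.toLinearMap) (B.map e.toLinearMap)
      ((Submodule.orderIsoMapComap e).isCompl h)
    simpa using h2
end hulls

end PartE

section PartF
open nonZeroDivisors

lemma dvd_total_of_chain {V : Type u} [CommRing V] (h : IsChainRing V) (a b : V) : a ∣ b ∨ b ∣ a := by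
  rcases h (Ideal.span {a}) (Ideal.span {b}) with h | h
  · right; exact Ideal.span_singleton_le_span_singleton.1 h
  · left; exact Ideal.span_singleton_le_span_singleton.1 h

section
variable {R : Type u} [CommRing R]

open TensorProduct in
lemma inj_restrict (V : Type u) [CommRing V] [Algebra R V] [Module.Flat R V]
    (M : Type u) [AddCommGroup M] [Module R M] [Module V M] [IsScalarTower R V M]
    (hM : Module.Injective V M) : Module.Injective R M := by
  constructor
  intro X Y _ _ _ _ f hf g
  let f' : V ⊗[R] X →ₗ[V] V ⊗[R] Y := f.baseChange V
  have hf' : Function.Injective f' := Module.Flat.lTensor_preserves_injective_linearMap f hf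
  let g' : V ⊗[R] X →ₗ[V] M := (TensorProduct.isBaseChange R X V).lift g
  obtain ⟨h, hh⟩ := hM.out f' hf' g'
  refine ⟨h.restrictScalars R ∘ₗ TensorProduct.mk R V Y 1, fun x => ?_⟩
  have h1 := hh ((1 : V) ⊗ₜ[R] x)
  have h2 : g' ((1 : V) ⊗ₜ[R] x) = g x := IsBaseChange.lift_eq _ g x
  rw [h2] at h1
  rw [← h1]
  simp [f']

lemma inj_extend (T : Submonoid R) (V : Type u) [CommRing V] [Algebra R V] [IsLocalization T V]
    (M : Type u) [AddCommGroup M] [Module R M] [Module V M] [IsScalarTower R V M]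
    (hM : Module.Injective R M) : Module.Injective V M := by
  constructor
  intro X Y _ _ _ _ f hf g
  let : Module R X := Module.compHom X (algebraMap R V)
  let : Module R Y := Module.compHom Y (algebraMap R V)
  have : IsScalarTower R V X := ⟨fun a q g => by rw [Algebra.smul_def, mul_smul]; rfl⟩
  have : IsScalarTower R V Y := ⟨fun a q g => by rw [Algebra.smul_def, mul_smul]; rfl⟩
  obtain ⟨h, hh⟩ := hM.out (f.restrictScalars R) hf (g.restrictScalars R)
  exact ⟨LinearMap.extendScalarsOfIsLocalization T V h, fun x => hh x⟩

variable {D : Type u} [AddCommGroup D] [Module R D]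

lemma indec_local (hD : Module.Injective R D) (hi : IsIndecomposableModule R D) :
    ∃ P : Ideal R, P.IsMaximal ∧ ∀ s, s ∉ P → Function.Bijective (fun x : D => s • x) := by
  obtain ⟨x0, hx0⟩ := @exists_ne D hi.1 0
  let I : Ideal R :=
    { carrier := {r | ∃ x : D, x ≠ 0 ∧ r • x = 0}
      zero_mem' := ⟨x0, hx0, zero_smul _ _⟩
      add_mem' := by
        rintro a b ⟨x, hx, hax⟩ ⟨y, hy, hby⟩
        obtain ⟨r, h1, h2⟩ := indec_uniform hD hi hx hy
        obtain ⟨t, ht⟩ := Submodule.mem_span_singleton.1 h2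
        refine ⟨r • x, h1, ?_⟩
        rw [add_smul, smul_comm a, hax, smul_zero, zero_add, ← ht, smul_comm b, hby, smul_zero]
      smul_mem' := by
        rintro c a ⟨x, hx, hax⟩
        exact ⟨x, hx, by rw [smul_assoc, hax, smul_zero]⟩ }
  have hI : I ≠ ⊤ := by
    rw [Ideal.ne_top_iff_one]
    rintro ⟨x, hx, h⟩
    exact hx (by simpa using h)
  obtain ⟨P, hP, hIP⟩ := Ideal.exists_le_maximal I hI
  refine ⟨P, hP, fun s hs => ?_⟩
  have hinj : ∀ x : D, s • x = 0 → x = 0 := by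
    intro x hx
    by_contra h0
    exact hs (hIP ⟨x, h0, hx⟩)
  constructor
  · intro x y hxy
    apply sub_eq_zero.1
    apply hinj
    rw [smul_sub]
    exact sub_eq_zero.2 hxy
  · intro m
    exact divMod_of_injective hD s m (fun c hc => hinj _ (by rw [smul_smul, mul_comm, hc, zero_smul]))

lemma isLocalizedModule_id_of_bij (T : Submonoid R)
    (h : ∀ s ∈ T, Function.Bijective (fun x : D => s • x)) :
    IsLocalizedModule T (LinearMap.id : D →ₗ[R] D) where
  map_units s := by
    rw [Module.End.isUnit_iff]
    exact h s s.2
  surj y := ⟨(y, 1), by simp⟩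
  exists_of_eq h := ⟨1, by simpa using h⟩

lemma loc_injective (hD : Module.Injective R D) (P : Ideal R) [P.IsPrime]
    (hbij : ∀ s, s ∉ P → Function.Bijective (fun x : D => s • x))
    (hV : ∀ a b : Localization.AtPrime P, a ∣ b ∨ b ∣ a)
    (h1 : IsCoherentRing (Localization.AtPrime P) ∨ ¬ IsSemicoherentRing (Localization.AtPrime P))
    (S : Submonoid R) : Module.Injective R (LocalizedModule S D) := by
  have hid := isLocalizedModule_id_of_bij (D := D) P.primeCompl (fun s hs => hbij s hs)
  let V := Localization.AtPrime P
  let : Module V D := IsLocalizedModule.module P.primeCompl (LinearMap.id : D →ₗ[R] D)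
  have : IsScalarTower R V D :=
    IsLocalizedModule.isScalarTower_module P.primeCompl (LinearMap.id : D →ₗ[R] D)
  have hDV : Module.Injective V D := inj_extend P.primeCompl V D hD
  let S' := Algebra.algebraMapSubmonoid V S
  let M := LocalizedModule S' D
  let f : D →ₗ[V] M := LocalizedModule.mkLinearMap S' D
  have hM : Module.Injective V M := chain_injective hV S' f hDV
    (chain_divMod hV S' f (divMod_of_injective hDV) (good_of_coherent_or hV h1))
  have : Module.Flat R V := IsLocalization.flat V P.primeCompl
  have hMR : Module.Injective R M := inj_restrict V M hM
  have : IsLocalizedModule S (f.restrictScalars R) := IsLocalizedModule.restrictScalars S f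
  exact injective_of_equiv (IsLocalizedModule.iso S (f.restrictScalars R)).symm hMR

lemma hull_equiv {G E : Type u} [AddCommGroup G] [Module R G] [AddCommGroup E] [Module R E]
    {f : G →ₗ[R] E} (hG : Module.Injective R G) (hf : IsInjectiveHull R G E f) :
    Function.Bijective f := by
  refine ⟨hf.2.1, ?_⟩
  obtain ⟨p, hp⟩ := hG.out f hf.2.1 LinearMap.id
  have hp' : ∀ x, p (f x) = x := hp
  have hker : LinearMap.ker p = ⊥ := by
    by_contra h
    apply hf.2.2 _ h
    rw [eq_bot_iff]
    rintro _ ⟨hx, ⟨y, rfl⟩⟩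
    have h1 : p (f y) = 0 := hx
    rw [hp'] at h1
    simp [h1]
  intro x
  exact ⟨p x, LinearMap.ker_eq_bot.1 hker (hp' _)⟩

lemma internal_equiv {E : Type u} [AddCommGroup E] [Module R E] {n : ℕ}
    {D : Fin n → Submodule R E} (h : DirectSum.IsInternal D) :
    Nonempty ((∀ i, D i) ≃ₗ[R] E) :=
  ⟨(DirectSum.linearEquivFunOnFintype R (Fin n) (fun i => D i)).symm ≪≫ₗ
    LinearEquiv.ofBijective (DirectSum.coeLinearMap D) h⟩

lemma one_imp_two (harith : IsArithmetical R)
    (h1 : ∀ (P : Ideal R) (hP : P.IsMaximal),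
        haveI := hP.isPrime
        IsCoherentRing (Localization.AtPrime P) ∨
          ¬ IsSemicoherentRing (Localization.AtPrime P))
    (S : Submonoid R) (G : Type u) [AddCommGroup G] [Module R G]
    (hG : Module.Injective R G) (hfin : HasFiniteGoldieDimension R G) :
    Module.Injective R (LocalizedModule S G) := by
  obtain ⟨E, f, hf, n, D, hintern, hDi⟩ := hfin
  obtain ⟨e⟩ := internal_equiv hintern
  let e2 : G ≃ₗ[R] (∀ i, D i) := LinearEquiv.ofBijective f (hull_equiv hG hf) ≪≫ₗ e.symm
  have hloc : ∀ i, Module.Injective R (LocalizedModule S (D i)) := by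
    intro i
    obtain ⟨P, hP, hbij⟩ := indec_local (hDi i).1 (hDi i).2
    have := hP.isPrime
    exact loc_injective (hDi i).1 P hbij (dvd_total_of_chain (harith P hP)) (h1 P hP) S
  let F := LinearMap.pi (fun i => LocalizedModule.mkLinearMap S (D i) ∘ₗ
    (LinearMap.proj i : (∀ i, D i) →ₗ[R] D i))
  have hF : IsLocalizedModule S F := IsLocalizedModule.pi S _
  have hF2 : IsLocalizedModule S (F ∘ₗ e2.toLinearMap) :=
    IsLocalizedModule.of_linearEquiv_right S F e2
  exact injective_of_equiv (IsLocalizedModule.iso S (F ∘ₗ e2.toLinearMap)).symm inferInstance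
end

end PartF

section PartG
open nonZeroDivisors

section
variable {R : Type u} [CommRing R]

lemma loc_FPI {G E : Type u} [AddCommGroup G] [Module R G] [AddCommGroup E] [Module R E]
    (f : G →ₗ[R] E) (hf : Function.Injective f) (S : Submonoid R) (hG : FPI R G)
    (hE : FPI R (LocalizedModule S E)) : FPI R (LocalizedModule S G) := by
  intro n K hK h
  obtain ⟨m, τ, hτ⟩ := K.fg_iff_exists_fin_linearMap.mp hK
  subst hτ
  let mG := LocalizedModule.mkLinearMap S G
  let mE := LocalizedModule.mkLinearMap S E
  let F := IsLocalizedModule.map S mG mE f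
  have hF : ∀ x, F (mG x) = mE (f x) := fun x => IsLocalizedModule.map_apply S mG mE f x
  obtain ⟨σE, hσE⟩ := hE n _ hK (F ∘ₗ h)
  obtain ⟨γ, s1, hγ⟩ := Module.FinitePresentation.exists_lift_of_isLocalizedModule S mG
    (h ∘ₗ τ.rangeRestrict)
  obtain ⟨η, s2, hη⟩ := Module.FinitePresentation.exists_lift_of_isLocalizedModule S mE σE
  have hγ' : ∀ x, mG (γ x) = (s1 : R) • h (τ.rangeRestrict x) := fun x => LinearMap.congr_fun hγ x
  have hη' : ∀ x, mE (η x) = (s2 : R) • σE x := fun x => LinearMap.congr_fun hη x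
  obtain ⟨t, ht⟩ := Module.Finite.exists_smul_of_comp_eq_of_isLocalizedModule S mE
    (((s1 : R) • η) ∘ₗ τ) (f ∘ₗ ((s2 : R) • γ)) (by
      apply LinearMap.ext
      intro x
      have h1 : σE (τ x) = F (h (τ.rangeRestrict x)) := hσE (τ.rangeRestrict x)
      simp only [LinearMap.comp_apply, LinearMap.smul_apply, map_smul]
      rw [hη', h1, ← hF, hγ', map_smul, smul_comm])
  have ht' : ∀ x, (t : R) • (s1 : R) • η (τ x) = f ((t : R) • (s2 : R) • γ x) := by
    intro x
    rw [map_smul]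
    exact LinearMap.congr_fun ht x
  obtain ⟨ψ, hψ⟩ := factor_range τ ((t : R) • (s2 : R) • γ) (by
    intro x hx
    apply hf
    simp only [LinearMap.smul_apply]
    rw [← ht', hx, map_zero, map_zero, smul_zero, smul_zero])
  obtain ⟨g, hg⟩ := hG n _ hK ψ
  refine ⟨LocalizedModule.divBy (t * s2 * s1) ∘ₗ mG ∘ₗ g, ?_⟩
  rintro ⟨_, x, rfl⟩
  have h2 := hg ⟨τ x, ⟨x, rfl⟩⟩
  rw [hψ] at h2
  simp only [LinearMap.smul_apply] at h2
  simp only [LinearMap.comp_apply]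
  rw [h2, mG.map_smul, mG.map_smul, hγ']
  have h3 := LocalizedModule.divBy_mul_by (t * s2 * s1) (h (τ.rangeRestrict x))
  rw [Module.algebraMap_end_apply] at h3
  simp only [Submonoid.coe_mul, mul_smul] at h3
  exact h3

lemma two_imp_three
    (h2 : ∀ (S : Submonoid R) (G : Type u) [AddCommGroup G] [Module R G],
        Module.Injective R G → HasFiniteGoldieDimension R G →
          Module.Injective R (LocalizedModule S G))
    (S : Submonoid R) (G : Type u) [AddCommGroup G] [Module R G]
    (hG : IsFPInjective R G) (hfin : HasFiniteGoldieDimension R G) :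
    IsFPInjective R (LocalizedModule S G) := by
  rw [isFPInjective_iff] at *
  obtain ⟨E, f, hf, n, D, hintern, hDi⟩ := hfin
  have hE : HasFiniteGoldieDimension R E :=
    ⟨E, LinearMap.id, ⟨hf.1, Function.injective_id, fun N hN => by simpa using hN⟩, n, D, hintern, hDi⟩
  exact loc_FPI f hf.2.1 S hG (FPI.of_injective (h2 S E hf.1 hE))

lemma isLocalization_Q (P : Ideal R) [P.IsPrime] :
    IsLocalization ((nonZeroDivisors (Localization.AtPrime P)).comap
      (algebraMap R (Localization.AtPrime P)))
      (Localization (nonZeroDivisors (Localization.AtPrime P))) :=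
  IsLocalization.localization_localization_isLocalization_of_has_all_units P.primeCompl _ _
    (fun _ hx => hx.mem_nonZeroDivisors)

lemma isLocalizedModule_Q (P : Ideal R) [P.IsPrime] (E : Type u) [AddCommGroup E] [Module R E] :
    IsLocalizedModule ((nonZeroDivisors (Localization.AtPrime P)).comap
      (algebraMap R (Localization.AtPrime P)))
      (TensorProduct.mk R (Localization (nonZeroDivisors (Localization.AtPrime P))) E 1) := by
  have := isLocalization_Q P
  rw [isLocalizedModule_iff_isBaseChange _ (Localization (nonZeroDivisors (Localization.AtPrime P)))]
  exact TensorProduct.isBaseChange _ _ _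

lemma three_imp_four
    (h3 : ∀ (S : Submonoid R) (G : Type u) [AddCommGroup G] [Module R G],
        IsFPInjective R G → HasFiniteGoldieDimension R G →
          IsFPInjective R (LocalizedModule S G))
    (P : Ideal R) (hP : P.IsMaximal) :
        haveI := hP.isPrime
        ∀ (E : Type u) [AddCommGroup E] [Module R E] (f : (R ⧸ P) →ₗ[R] E),
          IsInjectiveHull R (R ⧸ P) E f →
            IsFPInjective R
              (TensorProduct R (Localization (nonZeroDivisors (Localization.AtPrime P))) E) := by
  intro E _ _ f hf
  have := hP.isPrime
  have hl := isLocalizedModule_Q P E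
  have h := h3 ((nonZeroDivisors (Localization.AtPrime P)).comap
      (algebraMap R (Localization.AtPrime P))) E
    ((isFPInjective_iff R E).2 (FPI.of_injective hf.1))
    (goldie_of_indec hf.1 (hull_indec hP hf))
  rw [isFPInjective_iff] at *
  exact h.of_equiv (IsLocalizedModule.iso _
    (TensorProduct.mk R (Localization (nonZeroDivisors (Localization.AtPrime P))) E 1))

lemma bad_contra {V E M : Type u} [CommRing V] [AddCommGroup E] [Module V E] [AddCommGroup M]
    [Module V M] (hV : ∀ a b : V, a ∣ b ∨ b ∣ a) (φ : E →ₗ[V] M)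
    (hu : ∀ s ∈ V⁰, ∀ m : M, s • m = 0 → m = 0)
    (hz : ∀ x, φ x = 0 → ∃ s ∈ V⁰, s • x = 0)
    (hs : ∀ m, ∃ s ∈ V⁰, ∃ y, s • m = φ y)
    (hE : DivMod V E) (hM : DivMod V M) (e : E) (he : e ≠ 0) (hk : ∀ v : V, ¬ IsUnit v → v • e = 0)
    (a b s1 : V) (ha : a ≠ 0) (hb : b ≠ 0) (hab : a * b = 0)
    (hsat : ∀ c, c * a = 0 → InSat b c) (hs1 : s1 ∈ V⁰) (hs1u : ¬ IsUnit s1) : False := by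
  obtain ⟨x, hx⟩ := hE b e (by
    intro c hc
    apply hk
    intro hcu
    exact hb (hcu.mul_right_eq_zero.1 hc))
  obtain ⟨m, hm⟩ := hM a (φ x) (by
    intro c hc
    obtain ⟨s, hs, k, hk'⟩ := hsat c hc
    apply hu s hs
    apply hu s1 hs1
    rw [← map_smul, ← map_smul, ← map_smul, smul_smul s c, hk', mul_comm b, mul_smul k b, hx,
      smul_comm s1, hk s1 hs1u, smul_zero, map_zero])
  obtain ⟨t, ht, y, hy⟩ := hs m
  obtain ⟨s, hs', hsx⟩ := hz (t • x - a • y) (by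
    rw [map_sub, map_smul, map_smul, ← hy, ← hm, smul_comm, sub_self])
  have hst : s * t ∈ V⁰ := mul_mem hs' ht
  rcases hV (s * t) b with ⟨b', hb'⟩ | ⟨k, hk'⟩
  · have h0 : a * b' = 0 := nzd_cancel hst (by rw [← hab, hb']; ring)
    apply he
    rw [smul_sub, sub_eq_zero] at hsx
    rw [← hx, hb', mul_comm, mul_smul, mul_smul, hsx, smul_smul, smul_smul,
      show b' * s * a = s * (a * b') by ring, h0, mul_zero, zero_smul]
  · apply ha
    apply nzd_cancel hst
    rw [hk']
    linear_combination k * hab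

lemma divMod_loc (T : Submonoid R) (V : Type u) [CommRing V] [Algebra R V] [IsLocalization T V]
    (M : Type u) [AddCommGroup M] [Module R M] [Module V M] [IsScalarTower R V M]
    (h : DivMod R M) : DivMod V M := by
  intro a m hm
  obtain ⟨⟨a0, t⟩, hat⟩ := IsLocalization.surj T a
  simp only at hat
  have htu := IsLocalization.map_units V t
  obtain ⟨y, hy⟩ := h a0 m (by
    intro r hr
    rw [← algebraMap_smul V]
    apply hm
    rw [← htu.mul_left_eq_zero, mul_assoc, hat, ← map_mul, hr, map_zero])
  refine ⟨algebraMap R V t • y, ?_⟩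
  rw [smul_smul, hat, algebraMap_smul, hy]

lemma hull_bij {P : Ideal R} (hP : P.IsMaximal) {E : Type u} [AddCommGroup E] [Module R E]
    {f : (R ⧸ P) →ₗ[R] E} (hf : IsInjectiveHull R (R ⧸ P) E f) (s : R) (hs : s ∉ P) :
    Function.Bijective (fun x : E => s • x) := by
  have hinj : ∀ x : E, s • x = 0 → x = 0 := by
    intro x hx
    by_contra h0
    obtain ⟨r, hr⟩ := hull_mem hP hf h0
    apply hs
    have h1 : f (s • 1) = 0 := by
      rw [map_smul, ← hr, smul_comm, hx, smul_zero]
    have h2 : s • (1 : R ⧸ P) = 0 := hf.2.1 (by rw [h1, map_zero])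
    rw [← Ideal.Quotient.eq_zero_iff_mem, ← h2, Algebra.smul_def, mul_one]
    rfl
  constructor
  · intro x y hxy
    apply sub_eq_zero.1
    apply hinj
    rw [smul_sub]
    exact sub_eq_zero.2 hxy
  · intro m
    exact divMod_of_injective hf.1 s m
      (fun c hc => hinj _ (by rw [smul_smul, mul_comm, hc, zero_smul]))

lemma four_imp_one (harith : IsArithmetical R)
    (h4 : ∀ (P : Ideal R) (hP : P.IsMaximal),
        haveI := hP.isPrime
        ∀ (E : Type u) [AddCommGroup E] [Module R E] (f : (R ⧸ P) →ₗ[R] E),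
          IsInjectiveHull R (R ⧸ P) E f →
            IsFPInjective R
              (TensorProduct R (Localization (nonZeroDivisors (Localization.AtPrime P))) E))
    (P : Ideal R) (hP : P.IsMaximal) :
        haveI := hP.isPrime
        IsCoherentRing (Localization.AtPrime P) ∨
          ¬ IsSemicoherentRing (Localization.AtPrime P) := by
  have := hP.isPrime
  by_contra hn
  push Not at hn
  obtain ⟨hnc, hsc⟩ := hn
  have hV := dvd_total_of_chain (harith P hP)
  obtain ⟨a, b, s1, ha, hb, hab, hsat, hs1, hs1u⟩ := bad_pair hV hsc hnc
  obtain ⟨E, f, hf⟩ := exists_injectiveHull R (R ⧸ P)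
  have hfp := h4 P hP E f hf
  rw [isFPInjective_iff] at hfp
  have hbij := hull_bij hP hf
  have hid := isLocalizedModule_id_of_bij (D := E) P.primeCompl (fun s hs => hbij s hs)
  let V := Localization.AtPrime P
  let Q := Localization (nonZeroDivisors V)
  let : Module V E := IsLocalizedModule.module P.primeCompl (LinearMap.id : E →ₗ[R] E)
  have : IsScalarTower R V E :=
    IsLocalizedModule.isScalarTower_module P.primeCompl (LinearMap.id : E →ₗ[R] E)
  have hDV : Module.Injective V E := inj_extend P.primeCompl V E hf.1
  let M := TensorProduct R Q E
  have hl := isLocalizedModule_Q P E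
  have hMV : DivMod V M := divMod_loc P.primeCompl V M hfp.divMod
  let φ : E →ₗ[V] M := LinearMap.extendScalarsOfIsLocalization P.primeCompl V
    (TensorProduct.mk R Q E 1)
  refine bad_contra hV φ ?_ ?_ ?_ (divMod_of_injective hDV) hMV (f 1) (hull_one_ne hP hf) ?_
    a b s1 ha hb hab hsat hs1 hs1u
  · intro s hs m hm
    rw [← algebraMap_smul Q] at hm
    exact (IsLocalization.map_units Q (⟨s, hs⟩ : V⁰)).smul_left_cancel.1 (by rw [smul_zero]; exact hm)
  · intro x hx
    obtain ⟨c, hc⟩ := (IsLocalizedModule.eq_zero_iff ((nonZeroDivisors V).comap (algebraMap R V))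
      (TensorProduct.mk R Q E 1)).1 hx
    exact ⟨algebraMap R V c, c.2, by rw [algebraMap_smul]; exact hc⟩
  · intro m
    obtain ⟨⟨y, c⟩, hc⟩ := hl.surj m
    exact ⟨algebraMap R V c, c.2, y, by rw [algebraMap_smul]; exact hc⟩
  · intro v hv
    obtain ⟨r, t, rfl⟩ := IsLocalization.exists_mk'_eq P.primeCompl v
    have hr : r ∈ P := by
      by_contra hr
      exact hv ((IsLocalization.AtPrime.isUnit_mk'_iff V P r t).2 hr)
    have h0 : r • f 1 = 0 := by
      rw [← map_smul, Algebra.smul_def, mul_one]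
      change f (Ideal.Quotient.mk P r) = 0
      rw [Ideal.Quotient.eq_zero_iff_mem.2 hr, map_zero]
    apply (IsLocalization.map_units V t).smul_left_cancel.1
    rw [smul_smul, IsLocalization.mk'_spec', algebraMap_smul, h0, smul_zero]
end

end PartG

/-- Let `R` be an arithmetical ring.  TFAE:
(1) for each maximal ideal `P`, `R_P` is coherent or not semicoherent;
(2) `S⁻¹G` is injective for every multiplicative subset `S` and every injective module `G`
of finite Goldie dimension;
(3) `S⁻¹G` is FP-injective for every multiplicative subset `S` and every FP-injective module
`G` of finite Goldie dimension;
(4) for each maximal ideal `P`, `Q(R_P) ⊗_R E_R(R/P)` is FP-injective, where `Q(R_P)` is the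
total ring of quotients of `R_P`. -/
theorem arithmetical_tfae_localization_injective (R : Type u) [CommRing R]
    (harith : IsArithmetical R) :
    List.TFAE [
      ∀ (P : Ideal R) (hP : P.IsMaximal),
        haveI := hP.isPrime
        IsCoherentRing (Localization.AtPrime P) ∨
          ¬ IsSemicoherentRing (Localization.AtPrime P),
      ∀ (S : Submonoid R) (G : Type u) [AddCommGroup G] [Module R G],
        Module.Injective R G → HasFiniteGoldieDimension R G →
          Module.Injective R (LocalizedModule S G),
      ∀ (S : Submonoid R) (G : Type u) [AddCommGroup G] [Module R G],
        IsFPInjective R G → HasFiniteGoldieDimension R G →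
          IsFPInjective R (LocalizedModule S G),
      ∀ (P : Ideal R) (hP : P.IsMaximal),
        haveI := hP.isPrime
        ∀ (E : Type u) [AddCommGroup E] [Module R E] (f : (R ⧸ P) →ₗ[R] E),
          IsInjectiveHull R (R ⧸ P) E f →
            IsFPInjective R
              (TensorProduct R (Localization (nonZeroDivisors (Localization.AtPrime P))) E)] := by
  tfae_have 1 → 2 := by
    intro h S G _ _ hG hfin
    exact one_imp_two harith h S G hG hfin
  tfae_have 2 → 3 := by
    intro h S G _ _ hG hfin
    exact two_imp_three h S G hG hfin
  tfae_have 3 → 4 := by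
    intro h P hP
    exact three_imp_four h P hP
  tfae_have 4 → 1 := by
    intro h P hP
    exact four_imp_one harith h P hP
  tfae_finish
end

section
/- Let R be an arithmetical coherent ring. Then for each multiplicative subset S of R and each injective R-module G of finite Goldie dimension, the localization S^{-1}G is an injective R-module. -/
universe u

/-- Divisibility in injective modules. -/
theorem inj_div {R : Type u} [CommRing R] {G : Type u} [AddCommGroup G] [Module R G]
    (hG : Module.Injective R G) (i : R) (g : G) (h : ∀ t : R, t * i = 0 → t • g = 0) :
    ∃ k : G, i • k = g := by
  let F : R →ₗ[R] R := LinearMap.toSpanSingleton R R i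
  let f : (R ⧸ LinearMap.ker F) →ₗ[R] R := (LinearMap.ker F).liftQ F le_rfl
  have hf : Function.Injective f := by
    rw [← LinearMap.ker_eq_bot]
    exact Submodule.ker_liftQ_eq_bot _ _ _ le_rfl
  let g' : (R ⧸ LinearMap.ker F) →ₗ[R] G :=
    (LinearMap.ker F).liftQ (LinearMap.toSpanSingleton R G g) (by
      intro t ht
      simp only [F, LinearMap.mem_ker, LinearMap.toSpanSingleton_apply, smul_eq_mul] at ht ⊢
      exact h t ht)
  obtain ⟨e, he⟩ := hG.out f hf g'
  refine ⟨e 1, ?_⟩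
  have := he (Submodule.Quotient.mk 1)
  simp only [f, g', F, Submodule.liftQ_apply, LinearMap.toSpanSingleton_apply, one_smul] at this
  rw [← this, ← map_smul, smul_eq_mul, mul_one]

theorem uniform_kill {R : Type u} [CommRing R] {G : Type u} [AddCommGroup G] [Module R G]
    (S : Submonoid R) (N : Submodule R R) (hN : N.FG) (g : G)
    (h : ∀ t ∈ N, ∃ s ∈ S, s • t • g = 0) : ∃ s ∈ S, ∀ t ∈ N, s • t • g = 0 := by
  classical
  obtain ⟨T, rfl⟩ := hN
  have key : ∀ T' : Finset R, (T' : Set R) ⊆ T → ∃ s ∈ S, ∀ t ∈ T', s • t • g = 0 := by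
    intro T'
    induction T' using Finset.induction_on with
    | empty => intro _; exact ⟨1, S.one_mem, by simp⟩
    | insert a T' ha ih =>
      intro hT
      obtain ⟨s, hs, hs'⟩ := ih (fun x hx => hT (by simp [Finset.mem_coe.1 hx]))
      obtain ⟨s2, hs2, hs2'⟩ := h a (Submodule.subset_span (hT (by simp)))
      refine ⟨s * s2, S.mul_mem hs hs2, ?_⟩
      intro t ht
      rcases Finset.mem_insert.1 ht with rfl | ht
      · rw [mul_smul, hs2', smul_zero]
      · rw [mul_comm, mul_smul, hs' t ht, smul_zero]
  obtain ⟨s, hs, hs'⟩ := key T subset_rfl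
  refine ⟨s, hs, fun t ht => ?_⟩
  induction ht using Submodule.span_induction with
  | mem x hx => exact hs' x hx
  | zero => simp
  | add x y _ _ hx hy => rw [add_smul, smul_add, hx, hy, add_zero]
  | smul a x _ hx => rw [smul_eq_mul, mul_smul, smul_comm, hx, smul_zero]

theorem core_baer {R : Type u} [CommRing R] {G M : Type u} [AddCommGroup G] [Module R G]
    [AddCommGroup M] [Module R M] (hG : Module.Injective R G) (S C : Submonoid R) (hCS : C ≤ S)
    (hC : ∀ c ∈ C, ∀ g : G, c • g = 0 → g = 0)
    (hchain : ∀ a b : R, ∃ c ∈ C, b ∣ c * a ∨ a ∣ c * b)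
    (hfg : ∀ i : R, (LinearMap.ker (LinearMap.toSpanSingleton R R i)).FG)
    (φ : G →ₗ[R] M)
    (h1 : ∀ s ∈ S, ∀ m : M, s • m = 0 → m = 0)
    (h1' : ∀ s ∈ S, ∀ m : M, ∃ m', s • m' = m)
    (h2 : ∀ m : M, ∃ s ∈ S, ∃ g : G, s • m = φ g)
    (h3 : ∀ g : G, φ g = 0 → ∃ s ∈ S, s • g = 0) : Module.Baer R M := by
  intro I f
  suffices H : ∃ y : M, ∀ i : I, f i = (i : R) • y by
    obtain ⟨y, hy⟩ := H
    exact ⟨LinearMap.toSpanSingleton R M y, fun x hx => by simp [hy]⟩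
  have hcancel : ∀ s ∈ S, ∀ m m' : M, s • m = s • m' → m = m' := by
    intro s hs m m' h
    exact sub_eq_zero.1 (h1 s hs _ (by rw [smul_sub, h, sub_self]))
  have hcancelG : ∀ s ∈ C, ∀ m m' : G, s • m = s • m' → m = m' := by
    intro s hs m m' h
    exact sub_eq_zero.1 (hC s hs _ (by rw [smul_sub, h, sub_self]))
  have frel : ∀ (i j : I) (c r : R), c * (i : R) = j * r → c • f i = r • f j := by
    intro i j c r h
    rw [← map_smul, ← map_smul]
    congr 1
    ext
    simp [h, mul_comm]
  -- local solutions
  have hy : ∀ i : I, ∃ y : M, f i = (i : R) • y := by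
    intro i
    obtain ⟨s, hs, g, hg⟩ := h2 (f i)
    obtain ⟨s', hs', hk⟩ := uniform_kill S _ (hfg i) g (by
      intro t ht
      simp only [LinearMap.mem_ker, LinearMap.toSpanSingleton_apply, smul_eq_mul] at ht
      have h0 : φ (t • g) = 0 := by
        rw [map_smul, ← hg, smul_comm, ← map_smul]
        have : t • i = 0 := by ext; simpa using ht
        rw [this, map_zero, smul_zero]
      exact h3 _ h0)
    obtain ⟨k, hk'⟩ := inj_div hG (i : R) (s' • g) (by
      intro t ht
      rw [smul_comm]
      apply hk
      simpa using ht)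
    obtain ⟨y, hy⟩ := h1' (s' * s) (S.mul_mem hs' hs) (φ k)
    refine ⟨y, hcancel (s' * s) (S.mul_mem hs' hs) _ _ ?_⟩
    rw [smul_comm _ (i : R) y, hy, ← φ.map_smul, hk', φ.map_smul, ← hg, mul_smul]
  by_cases hp : ∃ i0 : I, ∀ i : I, ∃ s ∈ S, (i0 : R) ∣ s * i
  · obtain ⟨i0, hi0⟩ := hp
    obtain ⟨y, hy0⟩ := hy i0
    refine ⟨y, fun i => ?_⟩
    obtain ⟨s, hs, r, hr⟩ := hi0 i
    apply hcancel s hs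
    rw [frel i i0 s r hr, hy0, smul_smul, smul_smul, hr, mul_comm]
  push Not at hp
  obtain ⟨i0, hi0⟩ := hp 0
  have hi0 : ∀ s ∈ S, s * (i0 : R) ≠ 0 := by
    intro s hs h
    apply hi0 s hs
    rw [h]; exact dvd_zero _
  obtain ⟨y0, hy0⟩ := hy i0
  let J : I → Prop := fun j => ∃ c ∈ C, (j : R) ∣ c * i0
  let A : I → R → Prop := fun j a => ∀ s ∈ S, ∃ c ∈ C, s * (j : R) ∣ c * a
  have hlift : ∀ j : I, ∃ u : G, J j → f j = (j : R) • (y0 + φ u) := by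
    intro j
    by_cases hJ : J j
    swap
    · exact ⟨0, fun h => absurd h hJ⟩
    obtain ⟨c, hc, r, hr⟩ := hJ
    obtain ⟨y, hyj⟩ := hy j
    have hv : (i0 : R) • (y - y0) = 0 := by
      apply h1 c (hCS hc)
      have e := frel i0 j c r hr
      rw [hyj, hy0] at e
      rw [smul_sub, smul_sub, e, smul_smul, hr, smul_smul, mul_comm, sub_self]
    obtain ⟨s, hs, u, hu⟩ := h2 (y - y0)
    obtain ⟨s', hs', hk⟩ := h3 ((i0 : R) • u) (by
      rw [map_smul, ← hu, smul_comm, hv, smul_zero])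
    obtain ⟨k, hk'⟩ := inj_div hG s u (by
      intro t ht
      obtain ⟨d, hd, ⟨w, hw⟩ | ⟨w, hw⟩⟩ := hchain t (s' * i0)
      · apply hC d hd
        rw [smul_smul, hw, mul_comm, mul_smul, mul_smul, hk, smul_zero]
      · exfalso
        apply hi0 (s * (d * s')) (S.mul_mem hs (S.mul_mem (hCS hd) hs'))
        calc s * (d * s') * (i0 : R) = s * (d * (s' * i0)) := by ring
          _ = (t * s) * w := by rw [hw]; ring
          _ = 0 := by rw [ht, zero_mul])
    refine ⟨k, fun _ => ?_⟩
    have : y - y0 = φ k := by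
      apply hcancel s hs
      rw [hu, ← hk', map_smul]
    rw [← this, hyj]; simp
  choose u hu using hlift
  have cons1 : ∀ j k : I, J j → J k → ∀ c ∈ C, (k : R) ∣ c * j → ∀ a, A j a →
      a • u j = a • u k := by
    rintro j k hj hk c hc ⟨r, hr⟩ a ha
    have e := frel j k c r hr
    rw [hu j hj, hu k hk, smul_smul, smul_smul, hr, mul_comm r, ← hr, mul_smul, mul_smul] at e
    have e := hcancel c (hCS hc) _ _ e
    rw [smul_add, smul_add] at e
    have e := add_left_cancel e
    obtain ⟨s, hs, hk⟩ := h3 ((j : R) • (u j - u k)) (by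
      rw [smul_sub, map_sub, map_smul, map_smul, e, sub_self])
    obtain ⟨d, hd, w, hw⟩ := ha s hs
    have : a • (u j - u k) = 0 := by
      apply hC d hd
      rw [smul_smul, hw, mul_comm, mul_smul, mul_smul, hk, smul_zero]
    rwa [smul_sub, sub_eq_zero] at this
  have mono : ∀ j k : I, ∀ c ∈ C, (k : R) ∣ c * j → ∀ a, A j a → A k a := by
    rintro j k c hc ⟨r, hr⟩ a ha s hs
    obtain ⟨d, hd, w, hw⟩ := ha s hs
    refine ⟨c * d, C.mul_mem hc hd, r * w, ?_⟩
    calc c * d * a = c * (d * a) := by ring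
      _ = s * (c * j) * w := by rw [hw]; ring
      _ = _ := by rw [hr]; ring
  have cons : ∀ j k : I, J j → J k → ∀ a, A j a → A k a → a • u j = a • u k := by
    intro j k hj hk a haj hak
    obtain ⟨c, hc, h | h⟩ := hchain j k
    · exact cons1 j k hj hk c hc h a haj
    · exact (cons1 k j hk hj c hc h a hak).symm
  have hA0 : ∀ i : I, J i → ∃ j : I, J j ∧ A j i := by
    rintro i ⟨c, hc, hi⟩
    obtain ⟨j, hj⟩ := hp i
    have hAj : A j i := by
      intro s hs
      obtain ⟨d, hd, h | h⟩ := hchain i (s * j)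
      · exact ⟨d, hd, h⟩
      · exact absurd (by rwa [mul_assoc]) (hj (d * s) (S.mul_mem (hCS hd) hs))
    refine ⟨j, ?_, hAj⟩
    obtain ⟨d, hd, h⟩ := hAj 1 S.one_mem
    rw [one_mul] at h
    refine ⟨d * c, C.mul_mem hd hc, ?_⟩
    rw [mul_assoc]
    exact h.trans (mul_dvd_mul_left d hi)
  have hA : ∀ i : I, ∃ j : I, J j ∧ A j i := by
    intro i
    obtain ⟨c, hc, h | h⟩ := hchain i0 i
    · exact hA0 i ⟨c, hc, h⟩
    · obtain ⟨j, hj, hAj⟩ := hA0 i0 ⟨1, C.one_mem, by simp⟩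
      refine ⟨j, hj, fun s hs => ?_⟩
      obtain ⟨d, hd, h'⟩ := hAj s hs
      refine ⟨d * c, C.mul_mem hd hc, ?_⟩
      rw [mul_assoc]
      exact h'.trans (mul_dvd_mul_left d h)
  choose jj hJ hAj using hA
  have A_add : ∀ k a b, A k a → A k b → A k (a + b) := by
    intro k a b ha hb s hs
    obtain ⟨d, hd, h⟩ := ha s hs
    obtain ⟨d', hd', h'⟩ := hb s hs
    refine ⟨d * d', C.mul_mem hd hd', ?_⟩
    have : d * d' * (a + b) = d' * (d * a) + d * (d' * b) := by ring
    rw [this]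
    exact dvd_add (h.mul_left _) (h'.mul_left _)
  have A_smul : ∀ k r a, A k a → A k (r * a) := by
    intro k r a ha s hs
    obtain ⟨d, hd, h⟩ := ha s hs
    exact ⟨d, hd, by rw [mul_left_comm]; exact h.mul_left _⟩
  have common : ∀ a b : I, ∃ m : I, J m ∧ A m a ∧ A m b := by
    intro a b
    obtain ⟨c, hc, h | h⟩ := hchain (jj a) (jj b)
    · exact ⟨jj b, hJ b, mono _ _ c hc h _ (hAj a), hAj b⟩
    · exact ⟨jj a, hJ a, hAj a, mono _ _ c hc h _ (hAj b)⟩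
  let g : I →ₗ[R] G :=
    { toFun := fun a => (a : R) • u (jj a)
      map_add' := by
        intro a b
        obtain ⟨m, hm, ha, hb⟩ := common a b
        have e1 := cons (jj a) m (hJ a) hm a (hAj a) ha
        have e2 := cons (jj b) m (hJ b) hm b (hAj b) hb
        have e3 := cons (jj (a + b)) m (hJ _) hm _ (hAj (a + b)) (A_add m a b ha hb)
        rw [e1, e2, e3, ← add_smul]; rfl
      map_smul' := by
        intro r a
        have e := cons (jj (r • a)) (jj a) (hJ _) (hJ a) _ (hAj (r • a))
          (A_smul _ r a (hAj a))
        rw [e, RingHom.id_apply, smul_smul]; rfl }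
  obtain ⟨g', hg'⟩ := Module.Baer.of_injective hG I g
  refine ⟨y0 + φ (g' 1), fun i => ?_⟩
  have hx : (i : R) • g' 1 = (i : R) • u (jj i) := by
    rw [← map_smul, smul_eq_mul, mul_one, hg' i i.2]; rfl
  obtain ⟨c, hc, r, hr⟩ := hAj i 1 S.one_mem
  rw [one_mul] at hr
  apply hcancel c (hCS hc)
  rw [frel i (jj i) c r hr, hu _ (hJ i), smul_smul, mul_comm r, ← hr, mul_smul, smul_add,
    smul_add (i : R) y0, ← φ.map_smul, ← φ.map_smul, hx]

theorem exists_max_disjoint {R : Type u} [CommRing R] {G : Type u} [AddCommGroup G] [Module R G]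
    (A B : Submodule R G) (h : A ⊓ B = ⊥) :
    ∃ B', B ≤ B' ∧ A ⊓ B' = ⊥ ∧ ∀ X, B' ≤ X → A ⊓ X = ⊥ → X = B' := by
  obtain ⟨m, hm, hmax⟩ := zorn_le_nonempty₀ {X : Submodule R G | A ⊓ X = ⊥} (by
    intro c hc hchain y hy
    refine ⟨sSup c, ?_, fun z hz => le_sSup hz⟩
    rw [Set.mem_ofPred_eq, eq_bot_iff]
    rintro x ⟨hxA, hx⟩
    obtain ⟨X, hX, hxX⟩ := (Submodule.mem_sSup_of_directed ⟨y, hy⟩ hchain.directedOn).1 hx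
    have := hc hX
    rw [Set.mem_ofPred_eq] at this
    rw [← this]; exact ⟨hxA, hxX⟩) B h
  exact ⟨m, hm, hmax.1, fun X hX hAX => le_antisymm (hmax.2 hAX hX) hX⟩

theorem uniform_of_indec {R : Type u} [CommRing R] {G : Type u} [AddCommGroup G] [Module R G]
    (hG : Module.Injective R G) (hind : IsIndecomposableModule R G) (A B : Submodule R G)
    (h : A ⊓ B = ⊥) : A = ⊥ ∨ B = ⊥ := by
  obtain ⟨B', hB, hAB, hBmax⟩ := exists_max_disjoint A B h
  obtain ⟨A', hA, hBA, hAmax⟩ := exists_max_disjoint B' A (by rw [inf_comm]; exact hAB)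
  -- the projection
  have hinj : Function.Injective (A'.subtype.coprod B'.subtype) := by
    rw [← LinearMap.ker_eq_bot, LinearMap.ker_coprod_of_disjoint_range]
    · simp
    · simp only [Submodule.range_subtype]
      rw [disjoint_iff, inf_comm]; exact hBA
  obtain ⟨e, he⟩ := hG.out (A'.subtype.coprod B'.subtype) hinj
    (A'.subtype.comp (LinearMap.fst R A' B'))
  have heA : ∀ a ∈ A', e a = a := fun a ha => by simpa using he (⟨a, ha⟩, 0)
  have heB : ∀ b ∈ B', e b = 0 := fun b hb => by simpa using he (0, ⟨b, hb⟩)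
  have hker : LinearMap.ker e = B' := by
    apply hBmax _ (fun b hb => heB b hb)
    rw [eq_bot_iff]
    rintro x ⟨hx, hxe⟩
    have hxe : e x = 0 := hxe
    rw [heA x (hA hx)] at hxe
    exact hxe
  have hrange : LinearMap.range e = A' := by
    apply hAmax (LinearMap.range e) (fun a ha => LinearMap.mem_range.2 ⟨a, heA a ha⟩)
    by_contra hne
    have hX : A ⊓ (B' ⊓ LinearMap.range e).comap e = ⊥ := by
      rw [eq_bot_iff]
      rintro x ⟨hx, hxe, _⟩
      have hxe : e x ∈ B' := hxe
      rw [heA x (hA hx)] at hxe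
      rw [← hAB]; exact ⟨hx, hxe⟩
    have hX2 := hBmax _ (fun b hb => by
      rw [Submodule.mem_comap, heB b hb]; exact zero_mem _) hX
    apply hne
    rw [eq_bot_iff]
    rintro x ⟨hx, z, rfl⟩
    have : z ∈ B' := by
      rw [← hX2]; exact ⟨hx, z, rfl⟩
    rw [heB z this]; exact zero_mem _
  have hcompl : IsCompl A' B' := by
    constructor
    · rw [disjoint_iff, inf_comm]; exact hBA
    · rw [codisjoint_iff, eq_top_iff]
      intro x _
      have h1 : e x ∈ A' := by rw [← hrange]; exact ⟨x, rfl⟩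
      have h2 : x - e x ∈ B' := by
        rw [← hker, LinearMap.mem_ker, map_sub, heA _ h1, sub_self]
      have := Submodule.add_mem_sup h1 h2
      simpa using this
  rcases hind.2 A' B' hcompl with h | h
  · left; rw [eq_bot_iff, ← h]; exact hA
  · right; rw [eq_bot_iff, ← h]; exact hB

/-- Elements acting injectively. -/
def injSub (R : Type u) [CommRing R] (G : Type u) [AddCommGroup G] [Module R G] :
    Submonoid R where
  carrier := {c | ∀ g : G, c • g = 0 → g = 0}
  one_mem' := by intro g hg; simpa using hg
  mul_mem' := by
    intro a b ha hb g hg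
    rw [mul_smul] at hg
    exact hb _ (ha _ hg)

theorem chain_of_indec {R : Type u} [CommRing R] (harith : IsArithmetical R)
    {G : Type u} [AddCommGroup G] [Module R G]
    (hG : Module.Injective R G) (hind : IsIndecomposableModule R G) (a b : R) :
    ∃ c ∈ injSub R G, b ∣ c * a ∨ a ∣ c * b := by
  have hnt := hind.1
  let P : Ideal R :=
    { carrier := {r | ∃ g : G, g ≠ 0 ∧ r • g = 0}
      zero_mem' := by
        obtain ⟨g, hg⟩ := exists_ne (0 : G)
        exact ⟨g, hg, zero_smul _ _⟩
      add_mem' := by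
        rintro x y ⟨g, hg, hxg⟩ ⟨k, hk, hyk⟩
        by_contra hcon
        have := uniform_of_indec hG hind (Submodule.torsionBy R G x) (Submodule.torsionBy R G y)
          (by
            rw [eq_bot_iff]
            rintro z ⟨hz1, hz2⟩
            have hz1 : x • z = 0 := hz1
            have hz2 : y • z = 0 := hz2
            by_contra hz
            exact hcon ⟨z, hz, by rw [add_smul, hz1, hz2, add_zero]⟩)
        rcases this with h | h
        · exact hg ((Submodule.mem_bot R).1 (h ▸ (show g ∈ Submodule.torsionBy R G x from hxg)))
        · exact hk ((Submodule.mem_bot R).1 (h ▸ (show k ∈ Submodule.torsionBy R G y from hyk)))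
      smul_mem' := by
        rintro r x ⟨g, hg, hxg⟩
        exact ⟨g, hg, by rw [smul_eq_mul, mul_smul, hxg, smul_zero]⟩ }
  have hP : P ≠ ⊤ := by
    rw [Ideal.ne_top_iff_one]
    rintro ⟨g, hg, h⟩
    exact hg (by simpa using h)
  obtain ⟨m, hm, hPm⟩ := Ideal.exists_le_maximal P hP
  have hmem : ∀ c, c ∉ m → c ∈ injSub R G := by
    intro c hc g hg
    by_contra hne
    exact hc (hPm ⟨g, hne, hg⟩)
  haveI := hm.isPrime
  have aux : ∀ a b : R, algebraMap R (Localization.AtPrime m) b ∣ algebraMap R _ a →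
      ∃ c ∈ injSub R G, b ∣ c * a := by
    rintro a b ⟨z, hz⟩
    obtain ⟨r, s, rfl⟩ := IsLocalization.exists_mk'_eq m.primeCompl z
    have e : algebraMap R (Localization.AtPrime m) (s * a) = algebraMap R _ (b * r) := by
      rw [map_mul, hz, map_mul, mul_left_comm, IsLocalization.mk'_spec']
    obtain ⟨c, hc⟩ := (IsLocalization.eq_iff_exists m.primeCompl _).1 e
    refine ⟨c * s, Submonoid.mul_mem _ (hmem _ c.2) (hmem _ s.2), c * r, ?_⟩
    rw [mul_assoc, hc]; ring
  rcases harith m hm (Ideal.span {algebraMap R _ a}) (Ideal.span {algebraMap R _ b}) with h | h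
  · rw [Ideal.span_singleton_le_span_singleton] at h
    obtain ⟨c, hc, h⟩ := aux a b h
    exact ⟨c, hc, Or.inl h⟩
  · rw [Ideal.span_singleton_le_span_singleton] at h
    obtain ⟨c, hc, h⟩ := aux b a h
    exact ⟨c, hc, Or.inr h⟩

theorem ann_fg {R : Type u} [CommRing R] (hcoh : IsCoherentRing R) (i : R) :
    (LinearMap.ker (LinearMap.toSpanSingleton R R i)).FG := by
  haveI := hcoh (Ideal.span {i}) ⟨{i}, by simp⟩
  let l : R →ₗ[R] Ideal.span {i} :=
    (LinearMap.toSpanSingleton R R i).codRestrict (Ideal.span {i}) (by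
      intro c
      exact Ideal.mul_mem_left _ _ (Ideal.subset_span rfl))
  have hl : Function.Surjective l := by
    rintro ⟨x, hx⟩
    obtain ⟨c, rfl⟩ := Ideal.mem_span_singleton'.1 hx
    exact ⟨c, Subtype.ext rfl⟩
  have := Module.FinitePresentation.fg_ker l hl
  have hk : LinearMap.ker l = LinearMap.ker (LinearMap.toSpanSingleton R R i) := by
    ext t
    rw [LinearMap.mem_ker, LinearMap.mem_ker]
    exact Subtype.ext_iff
  rwa [hk] at this

theorem indec_case {R : Type u} [CommRing R]
    (harith : IsArithmetical R) (hcoh : IsCoherentRing R)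
    (S : Submonoid R) (G : Type u) [AddCommGroup G] [Module R G]
    (hG : Module.Injective R G) (hind : IsIndecomposableModule R G) :
    Module.Injective R (LocalizedModule S G) := by
  let φ := LocalizedModule.mkLinearMap S G
  have hb : ∀ s ∈ S, Function.Bijective (fun m : LocalizedModule S G => s • m) := by
    intro s hs
    have := (Module.End.isUnit_iff _).1 (IsLocalizedModule.map_units φ ⟨s, hs⟩)
    exact this
  have s1 : ∀ s ∈ S, ∀ m : LocalizedModule S G, s • m = 0 → m = 0 := fun s hs m hm =>
    (hb s hs).1 (by simpa using hm)
  have s2 : ∀ s ∈ S, ∀ m : LocalizedModule S G, ∃ m', s • m' = m := fun s hs m => (hb s hs).2 m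
  have s3 : ∀ m : LocalizedModule S G, ∃ s ∈ S, ∃ g : G, s • m = φ g := by
    intro m
    obtain ⟨⟨g, s⟩, h⟩ := IsLocalizedModule.surj S φ m
    exact ⟨s, s.2, g, h⟩
  have s4 : ∀ g : G, φ g = 0 → ∃ s ∈ S, s • g = 0 := by
    intro g hg
    obtain ⟨c, hc⟩ := IsLocalizedModule.exists_of_eq (S := S) (f := φ) (x₁ := g) (x₂ := 0)
      (by rw [hg, map_zero])
    rw [smul_zero] at hc
    exact ⟨c, c.2, hc⟩
  let C := injSub R G
  have c1 : ∀ c ∈ C, ∀ m : LocalizedModule S G, c • m = 0 → m = 0 := by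
    intro c hc m hm
    obtain ⟨s, hs, g, hg⟩ := s3 m
    obtain ⟨s', hs', h⟩ := s4 (c • g) (by rw [map_smul, ← hg, smul_comm, hm, smul_zero])
    rw [smul_comm] at h
    have h := hc _ h
    apply s1 s hs
    rw [hg]
    apply s1 s' hs'
    rw [← map_smul, h, map_zero]
  have c2 : ∀ c ∈ C, ∀ m : LocalizedModule S G, ∃ m', c • m' = m := by
    intro c hc m
    obtain ⟨s, hs, g, hg⟩ := s3 m
    obtain ⟨k, hk⟩ := inj_div hG c g (by
      intro t ht
      apply hc
      rw [smul_smul, mul_comm, ht, zero_smul])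
    obtain ⟨m', hm'⟩ := s2 s hs (φ k)
    refine ⟨m', (hb s hs).1 ?_⟩
    change s • c • m' = s • m
    rw [smul_comm, hm', hg, ← map_smul, hk]
  apply Module.Baer.injective
  refine core_baer hG (S ⊔ C) C le_sup_right (fun c hc => hc) (chain_of_indec harith hG hind)
    (ann_fg hcoh) φ ?_ ?_ ?_ ?_
  · intro x hx m hm
    obtain ⟨s, hs, c, hc, rfl⟩ := Submonoid.mem_sup.1 hx
    rw [mul_smul] at hm
    exact c1 c hc _ (s1 s hs _ hm)
  · intro x hx m
    obtain ⟨s, hs, c, hc, rfl⟩ := Submonoid.mem_sup.1 hx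
    obtain ⟨m1, rfl⟩ := s2 s hs m
    obtain ⟨m2, rfl⟩ := c2 c hc m1
    exact ⟨m2, mul_smul _ _ _⟩
  · intro m
    obtain ⟨s, hs, h⟩ := s3 m
    exact ⟨s, (le_sup_left : S ≤ S ⊔ C) hs, h⟩
  · intro g hg
    obtain ⟨s, hs, h⟩ := s4 g hg
    exact ⟨s, (le_sup_left : S ≤ S ⊔ C) hs, h⟩

/-- Over an arithmetical coherent ring, the localization of an injective
module of finite Goldie dimension is injective. -/
theorem localization_injective_of_arithmetical_coherent (R : Type u) [CommRing R]
    (harith : IsArithmetical R) (hcoh : IsCoherentRing R)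
    (S : Submonoid R) (G : Type u) [AddCommGroup G] [Module R G]
    (hG : Module.Injective R G) (hGoldie : HasFiniteGoldieDimension R G) :
    Module.Injective R (LocalizedModule S G) := by
  obtain ⟨E, f, ⟨hE, hf, hess⟩, n, D, hD, hDi⟩ := hGoldie
  obtain ⟨r, hr⟩ := hG.out f hf LinearMap.id
  have hker : LinearMap.ker r = ⊥ := by
    by_contra hne
    apply hess _ hne
    rw [eq_bot_iff]
    rintro x ⟨hx, z, rfl⟩
    have hx : r (f z) = 0 := hx
    rw [hr] at hx
    have hx : z = 0 := hx
    simp [hx]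
  have hsurj : Function.Surjective f := by
    intro x
    refine ⟨r x, LinearMap.ker_eq_bot.1 hker ?_⟩
    rw [hr]; rfl
  let e1 : G ≃ₗ[R] E := LinearEquiv.ofBijective f ⟨hf, hsurj⟩
  let e2 : (DirectSum (Fin n) fun i => D i) ≃ₗ[R] E :=
    LinearEquiv.ofBijective (DirectSum.coeLinearMap D) hD
  let e3 := DirectSum.linearEquivFunOnFintype R (Fin n) (fun i => D i)
  let e : G ≃ₗ[R] (∀ i, D i) := e1.trans (e2.symm.trans e3)
  haveI : ∀ i, Module.Injective R (LocalizedModule S (D i)) := fun i =>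
    indec_case harith hcoh S (D i) (hDi i).1 (hDi i).2
  let ψ : (∀ i, D i) →ₗ[R] (∀ i, LocalizedModule S (D i)) :=
    LinearMap.pi fun i => LocalizedModule.mkLinearMap S (D i) ∘ₗ LinearMap.proj i
  haveI : IsLocalizedModule S ψ := inferInstance
  haveI : IsLocalizedModule S (ψ ∘ₗ e.toLinearMap) :=
    IsLocalizedModule.of_linearEquiv_right S ψ e
  let e' : LocalizedModule S G ≃ₗ[R] (∀ i, LocalizedModule S (D i)) :=
    IsLocalizedModule.linearEquiv S (LocalizedModule.mkLinearMap S G) (ψ ∘ₗ e.toLinearMap)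
  have : Module.Injective R (∀ i, LocalizedModule S (D i)) := inferInstance
  exact Module.Baer.injective (Module.Baer.of_equiv e'.symm (Module.Baer.of_injective this))
end

section
/- Let R be a reduced arithmetical ring. Then for each multiplicative subset S of R and each injective R-module G of finite Goldie dimension, the localization S^{-1}G is an injective R-module. -/
universe u

theorem aux_exists_max {R : Type u} [CommRing R] {E : Type u} [AddCommGroup E] [Module R E]
    (A B : Submodule R E) (h : Disjoint A B) :
    ∃ M : Submodule R E, A ≤ M ∧ Disjoint M B ∧ ∀ N, M ≤ N → Disjoint N B → N ≤ M := by
  obtain ⟨M, hAM, hM⟩ := zorn_le_nonempty₀ {N : Submodule R E | Disjoint N B} (by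
    intro c hc hch y hy
    refine ⟨sSup c, ?_, fun z hz => le_sSup hz⟩
    exact (DirectedOn.disjoint_sSup_left hch.directedOn).2 (fun b hb => hc hb)) A h
  exact ⟨M, hAM, hM.1, fun N h1 h2 => hM.2 h2 h1⟩

theorem aux_uniform {R : Type u} [CommRing R] {E : Type u} [AddCommGroup E] [Module R E]
    (hE : Module.Injective R E) (hind : IsIndecomposableModule R E)
    (A0 B0 : Submodule R E) (h : Disjoint A0 B0) : A0 = ⊥ ∨ B0 = ⊥ := by
  obtain ⟨A, hA0, hAB, hAmax⟩ := aux_exists_max A0 B0 h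
  obtain ⟨C, hC0, hCA, hCmax⟩ := aux_exists_max B0 A hAB.symm
  rw [Submodule.disjoint_def] at hAB hCA
  obtain ⟨p, hp⟩ := hE.out (A.subtype.coprod C.subtype) (by
    rw [← LinearMap.ker_eq_bot, LinearMap.ker_eq_bot']
    rintro ⟨⟨a, ha⟩, ⟨c, hc⟩⟩ hac
    simp only [LinearMap.coprod_apply, Submodule.subtype_apply] at hac
    have h1 : c = 0 := hCA c hc (by
      rw [eq_neg_of_add_eq_zero_right hac]; exact A.neg_mem ha)
    have h2 : a = 0 := by simpa [h1] using hac
    subst h1 h2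
    rfl) (A.subtype ∘ₗ LinearMap.fst R A C)
  have hpA : ∀ a ∈ A, p a = a := fun a ha => by simpa using hp (⟨a, ha⟩, 0)
  have hpC : ∀ c ∈ C, p c = 0 := fun c hc => by simpa using hp (0, ⟨c, hc⟩)
  have hr : LinearMap.range p ≤ A := by
    apply hAmax
    · intro a ha
      exact ⟨a, hpA a ha⟩
    · rw [Submodule.disjoint_def]
      rintro _ ⟨e, rfl⟩ hB
      by_contra hne
      have hnd : ¬ Disjoint (C ⊔ Submodule.span R {e}) A := by
        intro hd
        have := hCmax _ le_sup_left hd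
        exact hne (hpC e (this (Submodule.mem_sup_right (Submodule.mem_span_singleton_self e))))
      apply hnd
      rw [Submodule.disjoint_def]
      intro x hx hxA
      obtain ⟨c, hc, y, hy, rfl⟩ := Submodule.mem_sup.1 hx
      obtain ⟨r, rfl⟩ := Submodule.mem_span_singleton.1 hy
      have h1 := hpA _ hxA
      rw [map_add, hpC c hc, zero_add, map_smul] at h1
      apply hAB _ hxA
      rw [← h1]
      exact B0.smul_mem _ hB
  have hcompl : IsCompl A (LinearMap.ker p) := by
    constructor
    · rw [Submodule.disjoint_def]
      intro x hx hk
      rw [← hpA x hx]; exact hk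
    · rw [codisjoint_iff, eq_top_iff]
      intro e _
      refine Submodule.mem_sup.2 ⟨p e, hr ⟨e, rfl⟩, e - p e, ?_, by abel⟩
      rw [LinearMap.mem_ker, map_sub, hpA _ (hr ⟨e, rfl⟩), sub_self]
  rcases hind.2 _ _ hcompl with h1 | h1
  · left; rw [eq_bot_iff, ← h1]; exact hA0
  · right; rw [eq_bot_iff, ← h1]; exact fun b hb => hpC b (hC0 hb)

theorem aux_key {R : Type u} [CommRing R] [IsReduced R] {E : Type u} [AddCommGroup E] [Module R E]
    (hE : Module.Injective R E) (U : Submonoid R) (hU : ∀ u ∈ U, ∀ e : E, u • e = 0 → e = 0)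
    (hchain : ∀ a b : R, ∃ u ∈ U, ∃ c, u * a = c * b ∨ u * b = c * a) (S : Submonoid R) :
    Module.Injective R (LocalizedModule S E) := by
  have hB : Module.Baer R E := Module.Baer.of_injective hE
  apply Module.Baer.injective
  -- elements killed by `U`
  have hZ : ∀ r : R, (∃ u ∈ U, u * r = 0) → ∀ e : E, r • e = 0 := by
    rintro r ⟨u, hu, h⟩ e
    apply hU u hu
    rw [smul_smul, h, zero_smul]
  have hsq : ∀ a b c u v : R, u * a = c * b → v * (a * b) = 0 → (v * u) * a = 0 := by
    intro a b c u v h1 h2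
    have : IsNilpotent ((v * u) * a) := ⟨2, by
      linear_combination (v ^ 2 * u * a) * h1 + (v * u * c) * h2⟩
    exact this.eq_zero
  have hprime : ∀ a b : R, a * b = 0 → (∃ u ∈ U, u * a = 0) ∨ (∃ u ∈ U, u * b = 0) := by
    intro a b hab
    obtain ⟨u, hu, c, h | h⟩ := hchain a b
    · exact Or.inl ⟨1 * u, U.mul_mem U.one_mem hu, hsq a b c u 1 h (by simp [hab])⟩
    · exact Or.inr ⟨1 * u, U.mul_mem U.one_mem hu, hsq b a c u 1 h (by simp [mul_comm b a, hab])⟩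
  have hdiv : ∀ x : R, (¬ ∃ u ∈ U, u * x = 0) → ∀ e : E, ∃ y : E, x • y = e := by
    intro x hx e
    let F := LinearPMap.mkSpanSingleton' (σ := RingHom.id R) x e (by
      intro c hc
      rcases hprime c x hc with h | h
      · exact hZ c h e
      · exact absurd h hx)
    obtain ⟨g, hg⟩ := hB (Submodule.span R {x}) F.toFun
    refine ⟨g 1, ?_⟩
    rw [← map_smul, smul_eq_mul, mul_one, hg x (Submodule.mem_span_singleton_self x)]
    exact LinearPMap.mkSpanSingleton'_apply_self x e _ _
  by_cases hS : ∃ s ∈ S, ∃ u ∈ U, u * s = 0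
  · obtain ⟨s, hs, h⟩ := hS
    have hsub : ∀ z : LocalizedModule S E, z = 0 := by
      intro z
      induction z using LocalizedModule.induction_on with
      | h m t =>
        rw [← LocalizedModule.zero_mk t, LocalizedModule.mk_eq]
        refine ⟨⟨s, hs⟩, ?_⟩
        exact (hZ s h (t • m)).trans (hZ s h (t • (0 : E))).symm
    intro I g
    exact ⟨0, fun x hx => by rw [hsub (g _)]; rfl⟩
  push Not at hS
  let q : E →ₗ[R] LocalizedModule S E := LocalizedModule.mkLinearMap S E
  have hq0 : ∀ e, q e = 0 → ∃ s ∈ S, s • e = 0 := by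
    intro e he
    obtain ⟨s, hs⟩ := (IsLocalizedModule.eq_zero_iff S q).1 he
    exact ⟨s, s.2, hs⟩
  have hqs : Function.Surjective q := by
    intro z
    induction z using LocalizedModule.induction_on with
    | h m t =>
      obtain ⟨y, hy⟩ := hdiv t (by rintro ⟨u, hu, h⟩; exact hS t t.2 u hu h) m
      refine ⟨y, ?_⟩
      change LocalizedModule.mk y 1 = _
      rw [LocalizedModule.mk_eq]
      exact ⟨1, by simp only [one_smul]; exact hy⟩
  have hSinj : ∀ s ∈ S, ∀ z : LocalizedModule S E, s • z = 0 → z = 0 := by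
    intro s hs z hz
    obtain ⟨e, rfl⟩ := hqs z
    rw [← map_smul] at hz
    obtain ⟨t, ht, h⟩ := hq0 _ hz
    refine (IsLocalizedModule.eq_zero_iff S q).2 ⟨⟨t * s, S.mul_mem ht hs⟩, ?_⟩
    change (t * s) • e = 0
    rw [mul_smul, h]
  have hUinj : ∀ u ∈ U, ∀ z : LocalizedModule S E, u • z = 0 → z = 0 := by
    intro u hu z hz
    obtain ⟨e, rfl⟩ := hqs z
    rw [← map_smul] at hz
    obtain ⟨t, ht, h⟩ := hq0 _ hz
    refine (IsLocalizedModule.eq_zero_iff S q).2 ⟨⟨t, ht⟩, ?_⟩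
    change t • e = 0
    rw [smul_comm] at h
    exact hU u hu _ h
  intro J f
  -- the function as a relation-free helper
  have hy : ∀ x : J, ∃ y : E, q ((x : R) • y) = f x := by
    intro x
    by_cases hx : ∃ u ∈ U, u * (x : R) = 0
    · refine ⟨0, ?_⟩
      obtain ⟨u, hu, h⟩ := hx
      rw [smul_zero, map_zero]
      symm
      apply hUinj u hu
      rw [← map_smul]
      have : u • x = 0 := Subtype.ext h
      rw [this, map_zero]
    · obtain ⟨e, he⟩ := hqs (f x)
      obtain ⟨y, rfl⟩ := hdiv x hx e
      exact ⟨y, he⟩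
  have hrel : ∀ (x x' : J) (a b : R), a * x = b * x' → a • f x = b • f x' := by
    intro x x' a b h
    rw [← map_smul, ← map_smul]
    congr 1
    exact Subtype.ext h
  by_cases hpr : ∃ r : J, ∀ x : J, ∃ s ∈ S, ∀ u ∈ U, ∀ c, u * r ≠ c * (s * x)
  · obtain ⟨r, hr⟩ := hpr
    obtain ⟨y, hy⟩ := hy r
    refine ⟨LinearMap.toSpanSingleton R _ (q y), fun x hx => ?_⟩
    obtain ⟨s, hs, hn⟩ := hr ⟨x, hx⟩
    obtain ⟨u, hu, c, h | h⟩ := hchain (s * x) r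
    · have h1 := hrel ⟨x, hx⟩ r (u * s) c (by rw [← h]; ring)
      rw [← hy, map_smul, smul_smul, ← h] at h1
      rw [LinearMap.toSpanSingleton_apply, ← sub_eq_zero]
      apply hSinj s hs
      apply hUinj u hu
      rw [smul_smul, smul_sub, h1, smul_smul, mul_assoc, sub_self]
    · exact absurd h (hn u hu c)
  push Not at hpr
  choose Y hY using hy
  choose X hX using hpr
  -- uniqueness
  have huniq1 : ∀ (r : R) (x1 x2 : J), (∀ s ∈ S, ∃ u ∈ U, ∃ c, u * r = c * (s * x1)) →
      (∃ u ∈ U, ∃ d, u * (x1 : R) = d * x2) → r • Y x1 = r • Y x2 := by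
    rintro r x1 x2 h1 ⟨u, hu, d, h⟩
    have h2 := hrel x1 x2 u d h
    rw [← hY, ← hY, ← map_smul, ← map_smul, smul_smul, smul_smul, ← h, ← sub_eq_zero,
      ← map_sub, ← smul_sub] at h2
    obtain ⟨s, hs, h3⟩ := hq0 _ h2
    obtain ⟨v, hv, c, h4⟩ := h1 s hs
    rw [← sub_eq_zero, ← smul_sub]
    apply hU v hv
    apply hU u hu
    rw [smul_smul, smul_smul, mul_assoc, h4,
      show u * (c * (s * (x1 : R))) = c * (s * (u * x1)) by ring, mul_smul, mul_smul, h3, smul_zero]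
  have hmono : ∀ (r : R) (x1 x2 : J), (∀ s ∈ S, ∃ u ∈ U, ∃ c, u * r = c * (s * x1)) →
      (∃ u ∈ U, ∃ d, u * (x1 : R) = d * x2) → (∀ s ∈ S, ∃ u ∈ U, ∃ c, u * r = c * (s * x2)) := by
    rintro r x1 x2 h1 ⟨u, hu, d, h⟩ s hs
    obtain ⟨v, hv, c, h4⟩ := h1 s hs
    exact ⟨u * v, U.mul_mem hu hv, c * d, by linear_combination u * h4 + c * s * h⟩
  have hcomp : ∀ x1 x2 : J, (∃ u ∈ U, ∃ d, u * (x1 : R) = d * x2) ∨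
      (∃ u ∈ U, ∃ d, u * (x2 : R) = d * x1) := by
    intro x1 x2
    obtain ⟨u, hu, c, h | h⟩ := hchain x1 x2
    · exact Or.inl ⟨u, hu, c, h⟩
    · exact Or.inr ⟨u, hu, c, h⟩
  have huniq : ∀ (r : R) (x1 x2 : J), (∀ s ∈ S, ∃ u ∈ U, ∃ c, u * r = c * (s * x1)) →
      (∀ s ∈ S, ∃ u ∈ U, ∃ c, u * r = c * (s * x2)) → r • Y x1 = r • Y x2 := by
    intro r x1 x2 h1 h2
    rcases hcomp x1 x2 with h | h
    · exact huniq1 r x1 x2 h1 h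
    · exact (huniq1 r x2 x1 h2 h).symm
  let g : J →ₗ[R] E :=
    { toFun := fun r => (r : R) • Y (X r)
      map_add' := by
        intro r1 r2
        obtain ⟨x, hx1, hx2⟩ : ∃ x : J, (∀ s ∈ S, ∃ u ∈ U, ∃ c, u * (r1 : R) = c * (s * x)) ∧
            (∀ s ∈ S, ∃ u ∈ U, ∃ c, u * (r2 : R) = c * (s * x)) := by
          rcases hcomp (X r1) (X r2) with h | h
          · exact ⟨X r2, hmono _ _ _ (hX r1) h, hX r2⟩
          · exact ⟨X r1, hX r1, hmono _ _ _ (hX r2) h⟩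
        have hx3 : ∀ s ∈ S, ∃ u ∈ U, ∃ c, u * ((r1 + r2 : J) : R) = c * (s * x) := by
          intro s hs
          obtain ⟨u, hu, c, h⟩ := hx1 s hs
          obtain ⟨v, hv, d, h'⟩ := hx2 s hs
          refine ⟨u * v, U.mul_mem hu hv, v * c + u * d, ?_⟩
          rw [Submodule.coe_add]
          linear_combination v * h + u * h'
        rw [huniq _ _ _ (hX _) hx3, huniq _ _ _ (hX r1) hx1, huniq _ _ _ (hX r2) hx2,
          Submodule.coe_add, add_smul]
      map_smul' := by
        intro a r
        have hx3 : ∀ s ∈ S, ∃ u ∈ U, ∃ c, u * ((a • r : J) : R) = c * (s * (X r)) := by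
          intro s hs
          obtain ⟨u, hu, c, h⟩ := hX r s hs
          refine ⟨u, hu, a * c, ?_⟩
          rw [Submodule.coe_smul, smul_eq_mul]
          linear_combination a * h
        rw [huniq _ _ _ (hX _) hx3, Submodule.coe_smul, smul_assoc, RingHom.id_apply] }
  have hg : ∀ r : J, q (g r) = f r := by
    intro r
    obtain ⟨u, hu, c, h⟩ := hX r 1 S.one_mem
    rw [one_mul] at h
    have h1 := hrel r (X r) u c h
    rw [← hY (X r), ← map_smul q, smul_smul, ← h, mul_smul, map_smul, ← sub_eq_zero, ← smul_sub] at h1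
    exact (sub_eq_zero.1 (hUinj u hu _ h1)).symm
  obtain ⟨g', hg'⟩ := hB J g
  exact ⟨q ∘ₗ g', fun x hx => by rw [LinearMap.comp_apply, hg' x hx, hg]⟩

theorem aux_indec {R : Type u} [CommRing R] [IsReduced R] (harith : IsArithmetical R)
    {E : Type u} [AddCommGroup E] [Module R E]
    (hE : Module.Injective R E) (hind : IsIndecomposableModule R E) (S : Submonoid R) :
    Module.Injective R (LocalizedModule S E) := by
  let P : Ideal R :=
    { carrier := {r | ∃ e : E, e ≠ 0 ∧ r • e = 0}
      zero_mem' := by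
        obtain ⟨e, he⟩ := @exists_ne E hind.1 0
        exact ⟨e, he, zero_smul _ _⟩
      add_mem' := by
        rintro a b ⟨e, he, hae⟩ ⟨e', he', hbe⟩
        have hnd : ¬ Disjoint (Submodule.span R {e}) (Submodule.span R {e'}) := by
          intro hd
          rcases aux_uniform hE hind _ _ hd with h | h
          · exact he (Submodule.span_singleton_eq_bot.1 h)
          · exact he' (Submodule.span_singleton_eq_bot.1 h)
        rw [Submodule.disjoint_def] at hnd
        push Not at hnd
        obtain ⟨x, hx, hx', hne⟩ := hnd
        refine ⟨x, hne, ?_⟩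
        obtain ⟨c, rfl⟩ := Submodule.mem_span_singleton.1 hx
        obtain ⟨d, hd⟩ := Submodule.mem_span_singleton.1 hx'
        rw [add_smul, smul_comm, hae, ← hd, smul_comm b, hbe, smul_zero, smul_zero, add_zero]
      smul_mem' := by
        rintro c a ⟨e, he, hae⟩
        exact ⟨e, he, by rw [smul_assoc, hae, smul_zero]⟩ }
  have hP : P ≠ ⊤ := by
    rw [Ideal.ne_top_iff_one]
    rintro ⟨e, he, h⟩
    exact he (by simpa using h)
  obtain ⟨M, hM, hPM⟩ := Ideal.exists_le_maximal P hP
  haveI := hM.isPrime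
  have hc := harith M hM
  refine aux_key hE M.primeCompl ?_ ?_ S
  · intro u hu e h
    by_contra he
    exact hu (hPM ⟨e, he, h⟩)
  · have main : ∀ a b : R, Ideal.span {algebraMap R (Localization.AtPrime M) a} ≤
        Ideal.span {algebraMap R (Localization.AtPrime M) b} →
        ∃ u ∈ M.primeCompl, ∃ c, u * a = c * b := by
      intro a b h
      rw [Ideal.span_singleton_le_span_singleton] at h
      obtain ⟨z, hz⟩ := h
      obtain ⟨⟨c, t⟩, hct⟩ := IsLocalization.surj M.primeCompl z
      have h1 : algebraMap R (Localization.AtPrime M) (t * a) =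
          algebraMap R (Localization.AtPrime M) (c * b) := by
        rw [map_mul, map_mul, hz]
        simp only at hct
        rw [← hct]; ring
      obtain ⟨v, hv⟩ := (IsLocalization.eq_iff_exists M.primeCompl _).1 h1
      exact ⟨v * t, M.primeCompl.mul_mem v.2 t.2, v * c, by linear_combination hv⟩
    intro a b
    rcases hc (Ideal.span {algebraMap R _ a}) (Ideal.span {algebraMap R _ b}) with h | h
    · obtain ⟨u, hu, c, h⟩ := main a b h
      exact ⟨u, hu, c, Or.inl h⟩
    · obtain ⟨u, hu, c, h⟩ := main b a h
      exact ⟨u, hu, c, Or.inr h⟩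

/-- Over a reduced arithmetical ring, the localization of an injective
module of finite Goldie dimension is injective. -/
theorem localization_injective_of_arithmetical_reduced (R : Type u) [CommRing R]
    [IsReduced R] (harith : IsArithmetical R)
    (S : Submonoid R) (G : Type u) [AddCommGroup G] [Module R G]
    (hG : Module.Injective R G) (hGoldie : HasFiniteGoldieDimension R G) :
    Module.Injective R (LocalizedModule S G) := by
  obtain ⟨E, f, ⟨-, hfinj, hess⟩, n, D, hD, hDi⟩ := hGoldie
  obtain ⟨p, hp⟩ := hG.out f hfinj LinearMap.id
  have hker : LinearMap.ker p = ⊥ := by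
    by_contra hne
    apply hess _ hne
    rw [eq_bot_iff]
    rintro _ ⟨hx, ⟨y, rfl⟩⟩
    have h1 : p (f y) = 0 := hx
    rw [hp] at h1
    have h2 : y = 0 := h1
    rw [h2, map_zero]; exact Submodule.zero_mem _
  let e1 : E ≃ₗ[R] G := LinearEquiv.ofBijective p
    ⟨LinearMap.ker_eq_bot.1 hker, fun y => ⟨f y, hp y⟩⟩
  let e2 : (DirectSum (Fin n) fun i => D i) ≃ₗ[R] E :=
    LinearEquiv.ofBijective (DirectSum.coeLinearMap D) hD
  let e3 : G ≃ₗ[R] (∀ i, D i) :=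
    e1.symm ≪≫ₗ e2.symm ≪≫ₗ DirectSum.linearEquivFunOnFintype R (Fin n) (fun i => D i)
  haveI : ∀ i, Module.Injective R (LocalizedModule S (D i)) :=
    fun i => aux_indec harith (hDi i).1 (hDi i).2 S
  let F : (∀ i, D i) →ₗ[R] (∀ i, LocalizedModule S (D i)) :=
    .pi fun i => LocalizedModule.mkLinearMap S (D i) ∘ₗ .proj i
  haveI : IsLocalizedModule S F := inferInstance
  haveI : IsLocalizedModule S (F ∘ₗ e3.toLinearMap) := inferInstance
  have hpi : Module.Injective R (∀ i, LocalizedModule S (D i)) := inferInstance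
  exact ((Module.Baer.of_injective hpi).of_equiv
    (IsLocalizedModule.iso S (F ∘ₗ e3.toLinearMap)).symm).injective
end
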